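/- arXiv:2305.05856 — 3 statements merged into one kernel-verified Lean document; each statement's English description precedes it below -/
import Mathlib

section
/- (Failure of the Leibniz rule in v, spatially homogeneous case.) Let γ + 2s < 0 with −2s−1 < γ < 0, 0 < s < 1, and let g : ℝ³ → [0,∞) with ‖g‖_{L²_ℓ} < ∞ for some ℓ ≥ 3 and ∫_{ℝ³} g(v) dv > 0. Let 𝔑₂ ∈ ℤ₊³ with |𝔑₂| ≥ 5 be such that the weak derivative ∂^{𝔑₂}_v g exists with ∫_{ℝ³} |∂^{𝔑₂}_v g(v)| ⟨v⟩^{γ+2s} dv = +∞, while ∫_{ℝ³} |∂^{𝔑}_v g(v)| ⟨v⟩^{γ+2s} dv < ∞ for every multi-index 𝔑 with |𝔑| < |𝔑₂|. Then there exists χ ∈ C_c^∞(ℝ³) with 0 ≤ χ ≤ 1 such that the function (v,v_*,σ) ↦ Σ_{α+β=𝔑₂} B(v−v_*,σ) ∂^α_v g(v_*) ∂^β_v g(v) (χ(v') − χ(v)) is NOT absolutely integrable on ℝ³×ℝ³×S²; in particular the Leibniz-rule identity ⟨Q(g,g), (−1)^{|𝔑₂|}∂^{𝔑₂}_v χ⟩_v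 = ⟨Σ_{α+β=𝔑₂} Q(∂^α_v g, ∂^β_v g), χ⟩_v fails. -/
open MeasureTheory Real Filter Function Set
open scoped ENNReal Topology RealInnerProductSpace FourierTransform

noncomputable section

abbrev V3 : Type := EuclideanSpace ℝ (Fin 3)
abbrev X3 : Type := Fin 3 → ℝ

/-- Japanese bracket `⟨v⟩ = (1+|v|²)^{1/2}`. -/
def jap (v : V3) : ℝ := Real.sqrt (1 + ‖v‖ ^ 2)

/-- `⟨q⟩` for integer frequencies `q ∈ ℤ³`. -/
def japZ (m : Fin 3 → ℤ) : ℝ := Real.sqrt (1 + ∑ i, (m i : ℝ) ^ 2)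

/-- Fundamental domain of the torus `T³`. -/
def cube : Set X3 := Set.Icc 0 1

/-- Surface measure on the unit sphere `S² ⊂ ℝ³`
(two–dimensional Hausdorff measure restricted to the sphere). -/
def sphMeas : Measure V3 :=
  (MeasureTheory.Measure.hausdorffMeasure 2 : Measure V3).restrict (Metric.sphere 0 1)

/-- Post-collisional velocity `v' = (v+v_*)/2 + (|v-v_*|/2)σ`. -/
def vPost (v vs σ : V3) : V3 := (2 : ℝ)⁻¹ • (v + vs) + (‖v - vs‖ / 2) • σ

/-- Post-collisional velocity `v'_* = (v+v_*)/2 − (|v-v_*|/2)σ`. -/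
def vsPost (v vs σ : V3) : V3 := (2 : ℝ)⁻¹ • (v + vs) - (‖v - vs‖ / 2) • σ

/-- Boltzmann collision kernel `B(u,σ) = |u|^γ b((u/|u|)·σ)`. -/
def Bker (γ : ℝ) (b : ℝ → ℝ) (u σ : V3) : ℝ := ‖u‖ ^ γ * b ⟪‖u‖⁻¹ • u, σ⟫

/-- Assumptions on the non-cutoff angular kernel `b` with singularity exponent `1+2s`. -/
structure AngularKernel (s : ℝ) (b : ℝ → ℝ) : Prop where
  nonneg : ∀ t, 0 ≤ b t
  vanish : ∀ t : ℝ, t < 0 → b t = 0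
  bounds : ∃ C > (0 : ℝ), ∀ θ ∈ Set.Ioc (0 : ℝ) (π / 2),
    C * θ ^ (-1 - 2 * s) ≤ Real.sin θ * b (Real.cos θ) ∧
      Real.sin θ * b (Real.cos θ) ≤ C⁻¹ * θ ^ (-1 - 2 * s)

/-- Boltzmann collision operator `Q(g,f)`. -/
def Qop (γ : ℝ) (b : ℝ → ℝ) (g f : V3 → ℝ) (v : V3) : ℝ :=
  ∫ vs, (∫ σ, Bker γ b (v - vs) σ *
    (g (vsPost v vs σ) * f (vPost v vs σ) - g vs * f v) ∂sphMeas)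

/-- Cutoff collision operator `Q_ε(g,f)`, with the deviation angle `θ ≥ ε`. -/
def Qeps (γ : ℝ) (b : ℝ → ℝ) (ε : ℝ) (g f : V3 → ℝ) (v : V3) : ℝ :=
  ∫ vs, (∫ σ, (if ⟪‖v - vs‖⁻¹ • (v - vs), σ⟫ ≤ Real.cos ε then
    Bker γ b (v - vs) σ * (g (vsPost v vs σ) * f (vPost v vs σ) - g vs * f v)
    else 0) ∂sphMeas)

/-- Weighted `L^p_l` norm `‖⟨·⟩^l f‖_{L^p}` (extended-real valued). -/
def wLp (p : ℝ≥0∞) (l : ℝ) (f : V3 → ℂ) : ℝ≥0∞ :=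
  eLpNorm (fun v => jap v ^ l • f v) p volume

/-- Weighted Sobolev norm `‖f‖_{H^m_l} = ‖⟨D⟩^m (⟨·⟩^l f)‖_{L²}`, computed on the
Fourier side via Plancherel. -/
def sobN (m l : ℝ) (f : V3 → ℂ) : ℝ≥0∞ :=
  eLpNorm (fun ξ => jap ξ ^ m • 𝓕 (fun v => jap v ^ l • f v) ξ) 2 volume

/-- Character `e^{2πi m·x}` on the torus. -/
def eX (m : Fin 3 → ℤ) (x : X3) : ℂ :=
  Complex.exp (((2 * π * ∑ i, (m i : ℝ) * x i : ℝ) : ℂ) * Complex.I)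

/-- Fourier coefficient in the space variable: `F_x(f)(m,v) = ∫_{T³} e^{-2πim·x} f(x,v) dx`. -/
def Fx (f : X3 → V3 → ℂ) (m : Fin 3 → ℤ) : V3 → ℂ :=
  fun v => ∫ x in cube, (eX m x)⁻¹ * f x v

def toC (f : X3 → V3 → ℝ) : X3 → V3 → ℂ := fun x v => (f x v : ℂ)
def toC1 (f : V3 → ℝ) : V3 → ℂ := fun v => (f v : ℂ)

/-- Squared mixed norm `‖f‖²_{H^n_x X} = Σ_q ⟨q⟩^{2n} ‖F_x(f)(q,·)‖²_X`. -/
def hxNSq (n : ℝ) (N : (V3 → ℂ) → ℝ≥0∞) (f : X3 → V3 → ℂ) : ℝ≥0∞ :=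
  ∑' q : Fin 3 → ℤ, ENNReal.ofReal (japZ q ^ (2 * n)) * N (Fx f q) ^ 2

/-- Squared `H^n_x H^m_l` norm. -/
def hxSobSq (n m l : ℝ) (f : X3 → V3 → ℂ) : ℝ≥0∞ := hxNSq n (sobN m l) f

/-- Squared `H^n_x L²_l` norm. -/
def hxL2Sq (n l : ℝ) (f : X3 → V3 → ℂ) : ℝ≥0∞ := hxNSq n (wLp 2 l) f

/-- `L^∞_x L²_l` norm. -/
def linfxL2 (l : ℝ) (f : X3 → V3 → ℝ) : ℝ≥0∞ :=
  essSup (fun x => wLp 2 l fun v => (f x v : ℂ)) volume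

/-- A dyadic partition of unity `ψ, φ` on `ℝ³`, as used for the Littlewood–Paley
decompositions in phase and frequency space. -/
structure DyadicPartition (ψv φv : V3 → ℝ) : Prop where
  smooth_psi : ContDiff ℝ ((⊤ : ℕ∞) : WithTop ℕ∞) ψv
  smooth_phi : ContDiff ℝ ((⊤ : ℕ∞) : WithTop ℕ∞) φv
  nonneg_psi : ∀ ξ, 0 ≤ ψv ξ
  nonneg_phi : ∀ ξ, 0 ≤ φv ξ
  radial_psi : ∀ ξ η : V3, ‖ξ‖ = ‖η‖ → ψv ξ = ψv η
  radial_phi : ∀ ξ η : V3, ‖ξ‖ = ‖η‖ → φv ξ = φv η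
  supp_psi : ∀ ξ : V3, 4 / 3 < ‖ξ‖ → ψv ξ = 0
  supp_phi : ∀ ξ : V3, (‖ξ‖ < 3 / 4 ∨ 8 / 3 < ‖ξ‖) → φv ξ = 0
  partition : ∀ ξ : V3, ψv ξ + ∑' j : ℕ, φv ((2 : ℝ) ^ (-(j : ℝ)) • ξ) = 1

/-- Phase-space localization `P_k f = φ(2^{-k}·) f`, `k ≥ 0`. -/
def Pdy (φv : V3 → ℝ) (k : ℕ) (f : V3 → ℂ) : V3 → ℂ :=
  fun v => (φv ((2 : ℝ) ^ (-(k : ℝ)) • v) : ℂ) * f v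

/-- Frequency localization `F_j f = ℱ⁻¹(φ(2^{-j}·) ℱ f)`, `j ≥ 0`. -/
def Fdy (φv : V3 → ℝ) (j : ℕ) (f : V3 → ℂ) : V3 → ℂ :=
  𝓕⁻ fun ξ => (φv ((2 : ℝ) ^ (-(j : ℝ)) • ξ) : ℂ) * 𝓕 f ξ

/-- Frequency localization indexed by `j ∈ ℤ`, `j ≥ -1`, where `j = -1` uses `ψ`. -/
def FdyZ (ψv φv : V3 → ℝ) (j : ℤ) (f : V3 → ℂ) : V3 → ℂ :=
  𝓕⁻ fun ξ => ((if j = -1 then ψv ξ else φv ((2 : ℝ) ^ (-(j : ℝ)) • ξ)) : ℂ) * 𝓕 f ξ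

/-- The frequencies `m = (±⌊2^{(1-ε)j}⌋, 0, 0) ∈ M_j`. -/
def mIdx (ε : ℝ) (j : ℕ) (sgn : Bool) : Fin 3 → ℤ :=
  fun i => if i = 0 then (if sgn then 1 else -1) * ⌊(2 : ℝ) ^ ((1 - ε) * j)⌋ else 0

/-- The divergent sum in the definition of `R_sd(ℓ;ε,a)` (and of `H^n_sd(ℓ;ε,a)`):
`Σ_{j≥1} Σ_{l>aj} 2^{(2ℓa+2n(1-ε)+ε)j} Σ_{m∈M_j} ‖F_j P_l F_x(f)(m,·)‖²_{L²}`. -/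
def rsdSum (φv : V3 → ℝ) (ℓ ε a n : ℝ) (f : X3 → V3 → ℝ) : ℝ≥0∞ :=
  ∑' j : ℕ, ∑' l : ℕ,
    if 1 ≤ j ∧ a * j < l then
      ENNReal.ofReal ((2 : ℝ) ^ ((2 * ℓ * a + 2 * n * (1 - ε) + ε) * j)) *
        (eLpNorm (Fdy φv j (Pdy φv l (Fx (toC f) (mIdx ε j true)))) 2 volume ^ 2 +
          eLpNorm (Fdy φv j (Pdy φv l (Fx (toC f) (mIdx ε j false)))) 2 volume ^ 2)
    else 0

/-- Membership in the set of typical rough and slowly decaying data `R_sd(ℓ; ε, a)`. -/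
def memRsd (φv : V3 → ℝ) (ℓ ε a : ℝ) (f : X3 → V3 → ℝ) : Prop :=
  (∀ x v, 0 ≤ f x v) ∧ Measurable (fun p : X3 × V3 => f p.1 p.2) ∧
    (∀ (k : Fin 3 → ℤ) (x : X3) (v : V3), f (x + fun i => (k i : ℝ)) v = f x v) ∧
    linfxL2 ℓ f < ⊤ ∧ rsdSum φv ℓ ε a 0 f = ⊤

/-- Membership in the set of regular-in-`x` slowly decaying data `H^n_sd(ℓ; ε, a)`. -/
def memHnsd (φv : V3 → ℝ) (ℓ ε a n : ℝ) (f : X3 → V3 → ℝ) : Prop :=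
  (∀ x v, 0 ≤ f x v) ∧ Measurable (fun p : X3 × V3 => f p.1 p.2) ∧
    (∀ (k : Fin 3 → ℤ) (x : X3) (v : V3), f (x + fun i => (k i : ℝ)) v = f x v) ∧
    hxL2Sq n ℓ (toC f) < ⊤ ∧ rsdSum φv ℓ ε a n f = ⊤

/-- Test functions for the weak formulation of the Boltzmann equation: `C¹_t C²_{x,v}`
(here `C²` in all variables), periodic in `x`, compactly supported in `[0,∞)×T³×ℝ³`. -/
structure TestFn (φ : ℝ → X3 → V3 → ℝ) : Prop where
  smooth : ContDiff ℝ 2 fun p : ℝ × X3 × V3 => φ p.1 p.2.1 p.2.2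
  periodicX : ∀ (t : ℝ) (k : Fin 3 → ℤ) (x : X3) (v : V3),
    φ t (x + fun i => (k i : ℝ)) v = φ t x v
  compactSupp : ∃ R : ℝ, ∀ t x v, (R ≤ t ∨ R ≤ ‖v‖) → φ t x v = 0

/-- Smooth test functions on `ℝ_t × T³ × ℝ³_v`, compactly supported in `(t,v)`. -/
structure TestXV (φ : ℝ → X3 → V3 → ℝ) : Prop where
  smooth : ContDiff ℝ ((⊤ : ℕ∞) : WithTop ℕ∞) fun p : ℝ × X3 × V3 => φ p.1 p.2.1 p.2.2
  periodicX : ∀ (t : ℝ) (k : Fin 3 → ℤ) (x : X3) (v : V3),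
    φ t (x + fun i => (k i : ℝ)) v = φ t x v
  compactSupp : ∃ R : ℝ, ∀ t x v, (R ≤ |t| ∨ R ≤ ‖v‖) → φ t x v = 0

/-- Smooth test functions with time support inside `I`. -/
structure TestXVIn (I : Set ℝ) (φ : ℝ → X3 → V3 → ℝ) : Prop where
  smooth : ContDiff ℝ ((⊤ : ℕ∞) : WithTop ℕ∞) fun p : ℝ × X3 × V3 => φ p.1 p.2.1 p.2.2
  periodicX : ∀ (t : ℝ) (k : Fin 3 → ℤ) (x : X3) (v : V3),
    φ t (x + fun i => (k i : ℝ)) v = φ t x v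
  suppT : ∀ t ∉ I, ∀ x v, φ t x v = 0
  compactSupp : ∃ R : ℝ, ∀ t x v, (R ≤ |t| ∨ R ≤ ‖v‖) → φ t x v = 0

/-- Smooth test functions on `T³ × ℝ³_v`, compactly supported in `v`. -/
structure TestXV0 (φ : X3 → V3 → ℝ) : Prop where
  smooth : ContDiff ℝ ((⊤ : ℕ∞) : WithTop ℕ∞) fun p : X3 × V3 => φ p.1 p.2
  periodicX : ∀ (k : Fin 3 → ℤ) (x : X3) (v : V3), φ (x + fun i => (k i : ℝ)) v = φ x v
  compactV : ∃ R : ℝ, ∀ x v, R ≤ ‖v‖ → φ x v = 0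

def ddt (φ : ℝ → X3 → V3 → ℝ) (t : ℝ) (x : X3) (v : V3) : ℝ :=
  deriv (fun τ => φ τ x v) t

def vGradX (φ : ℝ → X3 → V3 → ℝ) (t : ℝ) (x : X3) (v : V3) : ℝ :=
  fderiv ℝ (fun y => φ t y v) x fun i => v i

/-- Entropy `H(f) = ∫∫ f log f`. -/
def Hfun (f : X3 → V3 → ℝ) : ℝ := ∫ x in cube, ∫ v, f x v * Real.log (f x v)

/-- Entropy dissipation functional `D(f)`. -/
def entDiss (γ : ℝ) (b : ℝ → ℝ) (f : X3 → V3 → ℝ) : ℝ :=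
  (4 : ℝ)⁻¹ * ∫ x in cube, ∫ v, ∫ vs, (∫ σ, Bker γ b (v - vs) σ *
    (f x (vsPost v vs σ) * f x (vPost v vs σ) - f x vs * f x v) *
    Real.log (f x (vsPost v vs σ) * f x (vPost v vs σ) / (f x vs * f x v)) ∂sphMeas)

/-- Product measure on `T³ × ℝ³`. -/
def tvMeas : Measure (X3 × V3) := (volume.restrict cube).prod volume

/-- Product measure on `A × T³ × ℝ³` for a time set `A`. -/
def tcubeMeas (A : Set ℝ) : Measure (ℝ × X3 × V3) :=
  (volume.restrict A).prod ((volume.restrict cube).prod volume)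

/-- Weak solution of the Boltzmann equation `∂_t f + v·∇_x f = Q(f,f)` on `[0,T]×T³×ℝ³`
with initial datum `f₀`. -/
structure IsWeakSolution (γ : ℝ) (b : ℝ → ℝ) (T : ℝ)
    (f₀ : X3 → V3 → ℝ) (f : ℝ → X3 → V3 → ℝ) : Prop where
  init_nonneg : ∀ x v, 0 ≤ f₀ x v
  init_periodicX : ∀ (k : Fin 3 → ℤ) (x : X3) (v : V3), f₀ (x + fun i => (k i : ℝ)) v = f₀ x v
  init_mass : Integrable (fun p : X3 × V3 => f₀ p.1 p.2 * (1 + ‖p.2‖ ^ 2)) tvMeas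
  init_entropy : Integrable (fun p : X3 × V3 => f₀ p.1 p.2 * Real.log (f₀ p.1 p.2)) tvMeas
  nonneg : ∀ t x v, 0 ≤ f t x v
  meas : Measurable fun p : ℝ × X3 × V3 => f p.1 p.2.1 p.2.2
  periodicX : ∀ (t : ℝ) (k : Fin 3 → ℤ) (x : X3) (v : V3),
    f t (x + fun i => (k i : ℝ)) v = f t x v
  bddL1 : ∃ C : ℝ, ∀ᵐ t ∂volume.restrict (Set.Icc 0 T),
    (∫ x in cube, ∫ v, f t x v * (1 + ‖v‖ ^ 2)) ≤ C ∧
      (∫ x in cube, ∫ v, f t x v * |Real.log (f t x v)|) ≤ C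
  massCons : ∀ t ∈ Set.Icc 0 T,
    (∫ x in cube, ∫ v, f t x v) = ∫ x in cube, ∫ v, f₀ x v
  momCons : ∀ t ∈ Set.Icc 0 T,
    (∫ x in cube, ∫ v, f t x v • v : V3) = ∫ x in cube, ∫ v, f₀ x v • v
  energyCons : ∀ t ∈ Set.Icc 0 T,
    (∫ x in cube, ∫ v, f t x v * ‖v‖ ^ 2) = ∫ x in cube, ∫ v, f₀ x v * ‖v‖ ^ 2
  entropyIneq : ∀ T' ∈ Set.Ioc 0 T,
    Hfun (f T') + (∫ t in Set.Icc 0 T', entDiss γ b (f t)) ≤ Hfun f₀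
  weakForm : ∀ φ : ℝ → X3 → V3 → ℝ, TestFn φ → ∀ T' ∈ Set.Icc 0 T,
    Tendsto (fun ε : ℝ => ∫ t in Set.Icc 0 T', ∫ x in cube, ∫ v,
        Qeps γ b ε (f t x) (f t x) v * φ t x v) (𝓝[>] 0)
      (𝓝 ((∫ x in cube, ∫ v, f T' x v * φ T' x v) -
          (∫ x in cube, ∫ v, f₀ x v * φ 0 x v) -
          (∫ t in Set.Icc 0 T', ∫ x in cube, ∫ v, f t x v * ddt φ t x v) -
          (∫ t in Set.Icc 0 T', ∫ x in cube, ∫ v, f t x v * vGradX φ t x v)))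

/-- Iterated partial derivative `∂^α_x` in the space variable. -/
def pdX (i : Fin 3) (g : X3 → ℝ) : X3 → ℝ := fun x => fderiv ℝ g x (Pi.single i 1)

def pdMX (α : Fin 3 → ℕ) (g : X3 → ℝ) : X3 → ℝ :=
  (pdX 0)^[α 0] ((pdX 1)^[α 1] ((pdX 2)^[α 2] g))

/-- Iterated partial derivative `∂^α_v` in the velocity variable. -/
def pdV (i : Fin 3) (g : V3 → ℝ) : V3 → ℝ :=
  fun v => fderiv ℝ g v (EuclideanSpace.single i 1)

def pdMV (α : Fin 3 → ℕ) (g : V3 → ℝ) : V3 → ℝ :=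
  (pdV 0)^[α 0] ((pdV 1)^[α 1] ((pdV 2)^[α 2] g))

/-- Order `|α|` of a multi-index. -/
def mOrder (α : Fin 3 → ℕ) : ℕ := α 0 + α 1 + α 2

/-- `g` is the weak derivative `∂^α_x u` on `T³×ℝ³` (against smooth test functions). -/
def HasWeakDerivX (α : Fin 3 → ℕ) (u g : X3 → V3 → ℝ) : Prop :=
  Measurable (fun p : X3 × V3 => g p.1 p.2) ∧
  ∀ φ : X3 → V3 → ℝ, TestXV0 φ →
    Integrable (fun p : X3 × V3 => g p.1 p.2 * φ p.1 p.2) tvMeas ∧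
    (∫ x in cube, ∫ v, u x v * pdMX α (fun y => φ y v) x) =
      (-1 : ℝ) ^ mOrder α * ∫ x in cube, ∫ v, g x v * φ x v

/-- `g` is the weak derivative `∂^α_v u` on `T³×ℝ³` (against smooth test functions). -/
def HasWeakDerivV (α : Fin 3 → ℕ) (u g : X3 → V3 → ℝ) : Prop :=
  Measurable (fun p : X3 × V3 => g p.1 p.2) ∧
  ∀ φ : X3 → V3 → ℝ, TestXV0 φ →
    Integrable (fun p : X3 × V3 => g p.1 p.2 * φ p.1 p.2) tvMeas ∧
    (∫ x in cube, ∫ v, u x v * pdMV α (φ x) v) =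
      (-1 : ℝ) ^ mOrder α * ∫ x in cube, ∫ v, g x v * φ x v

/-- Weighted `L¹_x L¹_w` norm `∫∫ |g| ⟨v⟩^w`. -/
def wL1 (w : ℝ) (g : X3 → V3 → ℝ) : ℝ≥0∞ :=
  ∫⁻ x in cube, ∫⁻ v, ENNReal.ofReal (|g x v| * jap v ^ w)

/-- `⟨D_x⟩^a`, defined through the Fourier series in `x`. -/
def DxPowX (a : ℝ) (g : X3 → ℂ) : X3 → ℂ :=
  fun x => ∑' m : Fin 3 → ℤ, (japZ m ^ a : ℝ) • ((∫ y in cube, (eX m y)⁻¹ * g y) * eX m x)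

/-- `⟨D_v⟩^r`, defined through the Fourier transform in `v`. -/
def DvPow (r : ℝ) (g : V3 → ℂ) : V3 → ℂ :=
  𝓕⁻ fun ξ => (jap ξ ^ r : ℝ) • 𝓕 g ξ

/-- The normalized Gaussian `μ(v) = e^{-|v|²/2}/(2π)^{3/2}`. -/
def stdGauss (v : V3) : ℝ := Real.exp (-‖v‖ ^ 2 / 2) / (2 * π) ^ ((3 : ℝ) / 2)


/-- Smooth compactly supported test functions on `ℝ³_v`. -/
structure TestV (φ : V3 → ℝ) : Prop where
  smooth : ContDiff ℝ ((⊤ : ℕ∞) : WithTop ℕ∞) φ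
  compactV : ∃ R : ℝ, ∀ v, R ≤ ‖v‖ → φ v = 0

/-- `g` is the weak derivative `∂^α_v u` on `ℝ³` (spatially homogeneous setting). -/
def HasWeakDerivV1 (α : Fin 3 → ℕ) (u g : V3 → ℝ) : Prop :=
  Measurable g ∧ ∀ φ : V3 → ℝ, TestV φ →
    Integrable (fun v => g v * φ v) ∧
    (∫ v, u v * pdMV α φ v) = (-1 : ℝ) ^ mOrder α * ∫ v, g v * φ v

/-- Strong solution (in the distributional sense, with the collision term interpreted
through the cutoff limit) of the Boltzmann equation on `(0,T)×T³×ℝ³`, together with the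
macroscopic bounds `m₀ ≤ ρ ≤ M₀`, `E ≤ E₀`, `H ≤ H₀`. -/
structure StrongSol (γ : ℝ) (b : ℝ → ℝ) (T : ℝ) (f : ℝ → X3 → V3 → ℝ)
    (m₀ M₀ E₀ H₀ : ℝ) : Prop where
  nonneg : ∀ t x v, 0 ≤ f t x v
  meas : Measurable fun p : ℝ × X3 × V3 => f p.1 p.2.1 p.2.2
  periodicX : ∀ (t : ℝ) (k : Fin 3 → ℤ) (x : X3) (v : V3),
    f t (x + fun i => (k i : ℝ)) v = f t x v
  pde : ∀ φ : ℝ → X3 → V3 → ℝ, TestXVIn (Set.Ioo 0 T) φ →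
    Tendsto (fun ε : ℝ => ∫ t in Set.Ioo 0 T, ∫ x in cube, ∫ v,
        Qeps γ b ε (f t x) (f t x) v * φ t x v) (𝓝[>] 0)
      (𝓝 (-(∫ t in Set.Ioo 0 T, ∫ x in cube, ∫ v,
        f t x v * (ddt φ t x v + vGradX φ t x v))))
  massLB : ∀ t ∈ Set.Ioo (0 : ℝ) T, ∀ x, m₀ ≤ ∫ v, f t x v
  massUB : ∀ t ∈ Set.Ioo (0 : ℝ) T, ∀ x, (∫ v, f t x v) ≤ M₀
  energyUB : ∀ t ∈ Set.Ioo (0 : ℝ) T, ∀ x, (∫ v, f t x v * ‖v‖ ^ 2) ≤ E₀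
  entropyUB : ∀ t ∈ Set.Ioo (0 : ℝ) T, ∀ x, (∫ v, f t x v * Real.log (f t x v)) ≤ H₀

/-- Solution (in the distributional sense, with the collision terms interpreted through
the cutoff limit) of the linear Boltzmann equation `∂_t h + v·∇_x h = Q(μ,h) + Q(h,μ)`. -/
structure LinearSol (γ : ℝ) (b : ℝ → ℝ) (T : ℝ) (h : ℝ → X3 → V3 → ℝ) : Prop where
  meas : Measurable fun p : ℝ × X3 × V3 => h p.1 p.2.1 p.2.2
  periodicX : ∀ (t : ℝ) (k : Fin 3 → ℤ) (x : X3) (v : V3),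
    h t (x + fun i => (k i : ℝ)) v = h t x v
  pde : ∀ φ : ℝ → X3 → V3 → ℝ, TestXVIn (Set.Ioo 0 T) φ →
    Tendsto (fun ε : ℝ => ∫ t in Set.Ioo 0 T, ∫ x in cube, ∫ v,
        (Qeps γ b ε stdGauss (h t x) v + Qeps γ b ε (h t x) stdGauss v) * φ t x v)
      (𝓝[>] 0)
      (𝓝 (-(∫ t in Set.Ioo 0 T, ∫ x in cube, ∫ v,
        h t x v * (ddt φ t x v + vGradX φ t x v))))

/-- Cutoff pairing `⟨Q_ε(g,h), f⟩` for complex-valued functions. -/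
def QpairEps (γ : ℝ) (b : ℝ → ℝ) (ε : ℝ) (g h f : V3 → ℂ) : ℂ :=
  ∫ v, ∫ vs, (∫ σ, (if ⟪‖v - vs‖⁻¹ • (v - vs), σ⟫ ≤ Real.cos ε then
      (Bker γ b (v - vs) σ : ℂ) * (g (vsPost v vs σ) * h (vPost v vs σ) - g vs * h v) * f v
    else 0) ∂sphMeas)

/-- Embedding of integer frequencies into `ℝ³`. -/
def mV (m : Fin 3 → ℤ) : V3 := (WithLp.equiv 2 (Fin 3 → ℝ)).symm fun i => (m i : ℝ)

/-- Fourier transform on `ℝ³ × ℝ³`. -/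
def FT6 (g : V3 → V3 → ℂ) (m ξ : V3) : ℂ :=
  ∫ x : V3, ∫ v : V3,
    Complex.exp (((-(2 * π * (⟪x, m⟫ + ⟪v, ξ⟫)) : ℝ) : ℂ) * Complex.I) * g x v

/-- The Fourier multiplier operator `T_M` on `ℝ³ × ℝ³` with symbol `M`. -/
def TMop (M : V3 → V3 → ℂ) (g : V3 → V3 → ℂ) (x v : V3) : ℂ :=
  ∫ m : V3, ∫ ξ : V3,
    Complex.exp (((2 * π * (⟪x, m⟫ + ⟪v, ξ⟫) : ℝ) : ℂ) * Complex.I) * (M m ξ * FT6 g m ξ)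

/-- Mixed Fourier transform on `T³ × ℝ³`. -/
def FTmix (f : X3 → V3 → ℂ) (m : Fin 3 → ℤ) (ξ : V3) : ℂ :=
  ∫ x in cube, ∫ v : V3,
    (eX m x)⁻¹ * (Complex.exp (((-(2 * π * ⟪v, ξ⟫) : ℝ) : ℂ) * Complex.I) * f x v)

/-- The multiplier operator `S_M` on `T³ × ℝ³` with symbol `M(m,ξ)`, `m ∈ ℤ³`. -/
def SMop (M : V3 → V3 → ℂ) (f : X3 → V3 → ℂ) (x : X3) (v : V3) : ℂ :=
  ∑' m : Fin 3 → ℤ, eX m x *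
    ∫ ξ : V3, Complex.exp (((2 * π * ⟪v, ξ⟫ : ℝ) : ℂ) * Complex.I) * (M (mV m) ξ * FTmix f m ξ)

theorem hausdorffMeasure_image_lt_top_of_contDiff {f : (Fin 2 → ℝ) → V3} (hf : ContDiff ℝ 1 f)
    {K : Set (Fin 2 → ℝ)} (hK : IsCompact K) : μH[2] (f '' K) < ⊤ := by
  refine hK.induction_on (p := fun K => μH[2] (f '' K) < ⊤) (by simp)
    (fun s t hst ht => (measure_mono (image_mono hst)).trans_lt ht)
    (fun s t hs ht => ?_) (fun x _ => ?_)
  · rw [image_union]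
    exact (measure_union_le _ _).trans_lt (ENNReal.add_lt_top.2 ⟨hs, ht⟩)
  · obtain ⟨L, t, ht, hL⟩ := hf.contDiffAt (x := x).exists_lipschitzOnWith
    refine ⟨t ∩ Metric.ball x 1,
      mem_nhdsWithin_of_mem_nhds (inter_mem ht (Metric.ball_mem_nhds x one_pos)), ?_⟩
    refine ((hL.mono inter_subset_left).hausdorffMeasure_image_le (by norm_num)).trans_lt ?_
    refine ENNReal.mul_lt_top (by simp) ?_
    have h2 : (μH[2] : Measure (Fin 2 → ℝ)) = volume := by
      simpa using hausdorffMeasure_pi_real (ι := Fin 2)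
    rw [h2]
    exact (measure_mono inter_subset_right).trans_lt measure_ball_lt_top

theorem hausdorffMeasure_sphere_lt_top : μH[2] (Metric.sphere (0 : V3) 1) < ⊤ := by
  let f : (Fin 2 → ℝ) → V3 := fun x =>
    !₂[Real.sin (x 0) * Real.cos (x 1), Real.sin (x 0) * Real.sin (x 1), Real.cos (x 0)]
  have hf : ContDiff ℝ 1 f := by
    rw [contDiff_euclidean]
    intro i
    fin_cases i <;> simp [f] <;> fun_prop
  refine (measure_mono ?_).trans_lt
    (hausdorffMeasure_image_lt_top_of_contDiff hf
      (isCompact_Icc (a := ![0, -π]) (b := ![π, π])))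
  intro σ hσ
  have hn : σ 0 ^ 2 + σ 1 ^ 2 + σ 2 ^ 2 = 1 := by
    have h := EuclideanSpace.norm_sq_eq σ
    rw [mem_sphere_zero_iff_norm.1 hσ, Fin.sum_univ_three] at h
    simpa using h.symm
  set w : ℂ := ⟨σ 0, σ 1⟩
  have hw : ‖w‖ = Real.sin (Real.arccos (σ 2)) := by
    rw [Real.sin_arccos, Complex.norm_eq_sqrt_sq_add_sq]
    congr 1
    simp only [w]
    linarith
  refine ⟨![Real.arccos (σ 2), w.arg], ⟨?_, ?_⟩, ?_⟩
  · intro i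
    fin_cases i
    · exact Real.arccos_nonneg _
    · exact (Complex.neg_pi_lt_arg w).le
  · intro i
    fin_cases i
    · exact Real.arccos_le_pi _
    · exact Complex.arg_le_pi w
  · ext i
    fin_cases i
    · simp [f, ← hw, Complex.norm_mul_cos_arg, w]
    · simp [f, ← hw, Complex.norm_mul_sin_arg, w]
    · simp only [f]
      exact Real.cos_arccos (by nlinarith) (by nlinarith)

instance : IsFiniteMeasure sphMeas :=
  ⟨by simpa [sphMeas] using hausdorffMeasure_sphere_lt_top⟩

/-- The spherical annulus of angles `θ` around `e` with `a ≤ sin θ ≤ 3a` in the hemisphere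
centred at `e`. -/
def sphAnnulus (e : V3) (a : ℝ) : Set V3 :=
  {σ | 0 ≤ ⟪e, σ⟫ ∧ a ^ 2 ≤ 1 - ⟪e, σ⟫ ^ 2 ∧ 1 - ⟪e, σ⟫ ^ 2 ≤ 9 * a ^ 2}

theorem measurableSet_sphAnnulus (e : V3) (a : ℝ) : MeasurableSet (sphAnnulus e a) := by
  have h : Continuous fun σ : V3 => ⟪e, σ⟫ := by fun_prop
  exact ((isClosed_le continuous_const h).inter
    ((isClosed_le continuous_const (continuous_const.sub (h.pow 2))).inter
      (isClosed_le (continuous_const.sub (h.pow 2)) continuous_const))).measurableSet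

theorem sq_le_sphMeas_sphAnnulus {e : V3} (he : ‖e‖ = 1) {a : ℝ} (ha : 0 ≤ a)
    (ha5 : 5 * a ^ 2 ≤ 1) : ENNReal.ofReal (a ^ 2) ≤ sphMeas (sphAnnulus e a) := by
  obtain ⟨B, hB⟩ := Orthonormal.exists_orthonormalBasis_extension_of_card_eq (𝕜 := ℝ) (E := V3)
    (ι := Fin 3) (by simp) (v := fun _ => e) (s := {0})
    (by
      refine ⟨fun _ => he, fun i j hij => ?_⟩
      exact absurd (Subsingleton.elim i j) hij)
  have hB0 : B 0 = e := hB 0 rfl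
  let P : V3 → Fin 2 → ℝ := fun σ => ![⟪B 1, σ⟫, ⟪B 2, σ⟫]
  have hP : LipschitzWith 1 P := by
    refine LipschitzWith.of_dist_le_mul fun x y => ?_
    have key : ∀ j : Fin 3, |⟪B j, x⟫ - ⟪B j, y⟫| ≤ ‖x - y‖ := fun j => by
      rw [← inner_sub_right]
      simpa using abs_real_inner_le_norm (B j) (x - y)
    rw [NNReal.coe_one, one_mul, dist_eq_norm x y]
    refine (dist_pi_le_iff (norm_nonneg _)).2 fun i => ?_
    fin_cases i
    · exact key 1
    · exact key 2
  have hsub : Icc ![a, 0] ![2 * a, a] ⊆ P '' (sphAnnulus e a ∩ Metric.sphere 0 1) := by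
    intro x hx
    have h0 : a ≤ x 0 := hx.1 0
    have h1 : 0 ≤ x 1 := hx.1 1
    have h2 : x 0 ≤ 2 * a := hx.2 0
    have h3 : x 1 ≤ a := hx.2 1
    have hle : x 0 ^ 2 + x 1 ^ 2 ≤ 1 := by nlinarith
    set z := √(1 - (x 0 ^ 2 + x 1 ^ 2))
    have hz2 : z ^ 2 = 1 - (x 0 ^ 2 + x 1 ^ 2) := Real.sq_sqrt (by linarith)
    let σ : V3 := B.repr.symm !₂[z, x 0, x 1]
    have hσ : ∀ i, ⟪B i, σ⟫ = !₂[z, x 0, x 1] i := fun i => by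
      rw [← B.repr_apply_apply, LinearIsometryEquiv.apply_symm_apply]
    have hσ0 : ⟪e, σ⟫ = z := by rw [← hB0, hσ]; rfl
    refine ⟨σ, ⟨⟨?_, ?_, ?_⟩, ?_⟩, ?_⟩
    · rw [hσ0]; positivity
    · rw [hσ0, hz2]; nlinarith
    · rw [hσ0, hz2]; nlinarith
    · rw [mem_sphere_zero_iff_norm, LinearIsometryEquiv.norm_map, EuclideanSpace.norm_eq,
        Real.sqrt_eq_one, Fin.sum_univ_three]
      simp
      linarith
    · ext i
      fin_cases i
      · exact hσ 1
      · exact hσ 2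
  have h2 : (μH[2] : Measure (Fin 2 → ℝ)) = volume := by
    simpa using hausdorffMeasure_pi_real (ι := Fin 2)
  rw [sphMeas, Measure.restrict_apply (measurableSet_sphAnnulus e a)]
  calc ENNReal.ofReal (a ^ 2) = volume (Icc ![a, 0] ![2 * a, a]) := by
        rw [Real.volume_Icc_pi, Fin.prod_univ_two, ← ENNReal.ofReal_mul (by simp; linarith)]
        congr 1
        simp
        ring
    _ ≤ μH[2] (P '' (sphAnnulus e a ∩ Metric.sphere 0 1)) := by
        rw [← h2]; exact measure_mono hsub
    _ ≤ _ := by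
        simpa using hP.hausdorffMeasure_image_le (d := 2) (by norm_num)
          (sphAnnulus e a ∩ Metric.sphere 0 1)

theorem AngularKernel.exists_lower_bound {s : ℝ} {b : ℝ → ℝ} (hb : AngularKernel s b)
    (hs : 0 < s) : ∃ c > (0 : ℝ), ∀ a t : ℝ, 0 < a → 0 ≤ t → a ^ 2 ≤ 1 - t ^ 2 →
      1 - t ^ 2 ≤ 9 * a ^ 2 → c * a ^ (-2 - 2 * s) ≤ b t := by
  obtain ⟨C, hC, hCb⟩ := hb.bounds
  refine ⟨C * 5 ^ (-2 - 2 * s), by positivity, fun a t ha ht h1 h2 => ?_⟩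
  set θ := Real.arccos t
  have ht1 : t < 1 := by nlinarith
  have hcos : Real.cos θ = t := Real.cos_arccos (by linarith) ht1.le
  have hθ0 : 0 < θ := Real.arccos_pos.2 ht1
  have hθ1 : θ ≤ π / 2 := Real.arccos_le_pi_div_two.2 ht
  have hsin2 : Real.sin θ ^ 2 = 1 - t ^ 2 := by rw [Real.sin_sq, hcos]
  have hsin0 : 0 < Real.sin θ := Real.sin_pos_of_pos_of_lt_pi hθ0 (by linarith [Real.pi_pos])
  have hsin : Real.sin θ ≤ 3 * a := by nlinarith
  have hj := Real.mul_le_sin hθ0.le hθ1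
  have hpi := Real.pi_lt_d2
  have hθa : θ ≤ 5 * a := by
    have h : 2 * θ ≤ π * Real.sin θ := by
      have := mul_le_mul_of_nonneg_left hj Real.pi_pos.le
      field_simp at this
      linarith
    nlinarith
  have hlow := (hCb θ ⟨hθ0, hθ1⟩).1
  rw [hcos] at hlow
  have hmono : (5 * a) ^ (-1 - 2 * s) ≤ θ ^ (-1 - 2 * s) :=
    Real.rpow_le_rpow_of_nonpos hθ0 hθa (by linarith)
  have h5 : (5 * a) ^ (-1 - 2 * s) = (5 * a) ^ (-2 - 2 * s) * (5 * a) := by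
    rw [← Real.rpow_add_one (by positivity)]; ring_nf
  have hsp : Real.sin θ * b t ≤ 5 * a * b t :=
    mul_le_mul_of_nonneg_right (by linarith) (hb.nonneg t)
  have : C * (5 * a) ^ (-2 - 2 * s) * (5 * a) ≤ b t * (5 * a) := by
    rw [mul_assoc, ← h5]
    nlinarith [mul_le_mul_of_nonneg_left hmono hC.le]
  have := le_of_mul_le_mul_right this (by positivity)
  rwa [Real.mul_rpow (by norm_num) ha.le, ← mul_assoc] at this

theorem norm_vPost_sub_sq {v vs σ : V3} (hσ : ‖σ‖ = 1) (hv : v - vs ≠ 0) :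
    ‖vPost v vs σ - v‖ ^ 2 =
      ‖v - vs‖ ^ 2 * ((1 - ⟪‖v - vs‖⁻¹ • (v - vs), σ⟫) / 2) := by
  have h : vPost v vs σ - v = (2 : ℝ)⁻¹ • (‖v - vs‖ • σ - (v - vs)) := by
    rw [vPost]
    module
  have hn : ‖v - vs‖ ≠ 0 := norm_ne_zero_iff.2 hv
  rw [h, norm_smul, mul_pow, norm_sub_sq_real, norm_smul, norm_norm, hσ, real_inner_smul_left,
    real_inner_smul_left, real_inner_comm]
  simp
  field_simp
  ring

theorem mul_le_norm_vPost_sub {v vs σ : V3} {a : ℝ} (hσ : ‖σ‖ = 1) (hv : v - vs ≠ 0)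
    (hmem : σ ∈ sphAnnulus (‖v - vs‖⁻¹ • (v - vs)) a) :
    ‖v - vs‖ * a / 2 ≤ ‖vPost v vs σ - v‖ := by
  obtain ⟨h0, h1, -⟩ := hmem
  refine abs_le_of_sq_le_sq' ?_ (norm_nonneg _) |>.2
  rw [norm_vPost_sub_sq hσ hv]
  set t := ⟪‖v - vs‖⁻¹ • (v - vs), σ⟫
  have ht : a ^ 2 / 4 ≤ (1 - t) / 2 := by nlinarith [sq_nonneg a, sq_nonneg t]
  nlinarith [mul_le_mul_of_nonneg_left ht (sq_nonneg ‖v - vs‖)]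

theorem jap_pos (v : V3) : 0 < jap v := Real.sqrt_pos.2 (by positivity)

theorem one_le_jap (v : V3) : 1 ≤ jap v := Real.one_le_sqrt.2 (by nlinarith [sq_nonneg ‖v‖])

theorem norm_le_jap (v : V3) : ‖v‖ ≤ jap v := Real.le_sqrt_of_sq_le (by linarith)

theorem measurable_jap : Measurable jap := by
  unfold jap
  fun_prop

theorem exists_le_lintegral_Bker {γ s : ℝ} {b : ℝ → ℝ} (hb : AngularKernel s b) (hs : 0 < s)
    (hγ : γ + 2 * s < 0) {r : ℝ} (hr : 0 < r) :
    ∃ c > (0 : ℝ), ∀ (χ : V3 → ℝ) (v vs : V3), (∀ w, ‖w‖ ≤ r → χ w = 1) →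
      (∀ w, 2 * r ≤ ‖w‖ → χ w = 0) → ‖v‖ ≤ r → 100 * r ≤ ‖vs‖ →
      ENNReal.ofReal (c * jap vs ^ (γ + 2 * s)) ≤
        ∫⁻ σ, ‖Bker γ b (v - vs) σ * (χ (vPost v vs σ) - χ v)‖ₑ ∂sphMeas := by
  obtain ⟨C, hC, hCb⟩ := hb.exists_lower_bound hs
  refine ⟨C * (6 * r) ^ (-2 * s) * 2 ^ (γ + 2 * s), by positivity,
    fun χ v vs h1 h0 hv hvs => ?_⟩
  set ρ := ‖v - vs‖ with hρ
  have hρl : 99 * r ≤ ρ := by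
    have := norm_sub_norm_le vs v
    rw [norm_sub_rev] at this
    linarith
  have hρu : ρ ≤ 2 * jap vs := by
    have := norm_sub_le v vs
    linarith [norm_le_jap vs]
  have hρ0 : 0 < ρ := by linarith
  have hne : v - vs ≠ 0 := norm_pos_iff.1 hρ0
  set e : V3 := ρ⁻¹ • (v - vs) with he
  have hen : ‖e‖ = 1 := by
    rw [he, norm_smul, norm_inv, Real.norm_of_nonneg hρ0.le, inv_mul_cancel₀ hρ0.ne']
  set a := 6 * r / ρ with ha
  have ha0 : 0 < a := by positivity
  have ha5 : 5 * a ^ 2 ≤ 1 := by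
    have : a ≤ 1 / 10 := by rw [ha, div_le_iff₀ hρ0]; linarith
    nlinarith
  have hρa : ρ * a = 6 * r := by rw [ha]; field_simp
  have hpow : ρ ^ γ * (C * a ^ (-2 - 2 * s)) * a ^ 2 =
      C * (6 * r) ^ (-2 * s) * ρ ^ (γ + 2 * s) := by
    have h2 : a ^ (-2 - 2 * s) * a ^ 2 = a ^ (-2 * s) := by
      rw [← Real.rpow_natCast a 2, ← Real.rpow_add ha0]
      congr 1
      push_cast
      ring
    have h3 : a ^ (-2 * s) = (6 * r) ^ (-2 * s) * ρ ^ (2 * s) := by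
      rw [ha, Real.div_rpow (by positivity) hρ0.le, neg_mul, Real.rpow_neg hρ0.le, div_inv_eq_mul]
    rw [Real.rpow_add hρ0, mul_assoc, mul_assoc C, h2, h3]
    ring
  have hB : ∀ σ ∈ sphAnnulus e a, ρ ^ γ * (C * a ^ (-2 - 2 * s)) ≤ Bker γ b (v - vs) σ :=
    fun σ hσ => mul_le_mul_of_nonneg_left (hCb a _ ha0 hσ.1 hσ.2.1 hσ.2.2) (by positivity)
  have hsph : ∀ᵐ σ ∂sphMeas, ‖σ‖ = 1 := by
    filter_upwards [ae_restrict_mem (μ := μH[2]) Metric.isClosed_sphere.measurableSet] with σ hσ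
    exact mem_sphere_zero_iff_norm.1 hσ
  have hmono : 2 ^ (γ + 2 * s) * jap vs ^ (γ + 2 * s) ≤ ρ ^ (γ + 2 * s) := by
    rw [← Real.mul_rpow (by norm_num) (jap_pos vs).le]
    exact Real.rpow_le_rpow_of_nonpos hρ0 hρu hγ.le
  calc ENNReal.ofReal (C * (6 * r) ^ (-2 * s) * 2 ^ (γ + 2 * s) * jap vs ^ (γ + 2 * s))
      ≤ ENNReal.ofReal (ρ ^ γ * (C * a ^ (-2 - 2 * s)) * a ^ 2) := by
        apply ENNReal.ofReal_le_ofReal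
        rw [hpow, mul_assoc]
        exact mul_le_mul_of_nonneg_left hmono (by positivity)
    _ = ENNReal.ofReal (ρ ^ γ * (C * a ^ (-2 - 2 * s))) * ENNReal.ofReal (a ^ 2) :=
        ENNReal.ofReal_mul (by positivity)
    _ ≤ ENNReal.ofReal (ρ ^ γ * (C * a ^ (-2 - 2 * s))) * sphMeas (sphAnnulus e a) := by
        gcongr
        exact sq_le_sphMeas_sphAnnulus hen ha0.le ha5
    _ = ∫⁻ _ in sphAnnulus e a, ENNReal.ofReal (ρ ^ γ * (C * a ^ (-2 - 2 * s))) ∂sphMeas :=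
        (setLIntegral_const _ _).symm
    _ ≤ ∫⁻ σ in sphAnnulus e a, ‖Bker γ b (v - vs) σ * (χ (vPost v vs σ) - χ v)‖ₑ ∂sphMeas := by
        refine lintegral_mono_ae ?_
        filter_upwards [ae_restrict_mem (measurableSet_sphAnnulus e a),
          ae_restrict_of_ae hsph] with σ hσ hσ1
        have hfar : 2 * r ≤ ‖vPost v vs σ‖ := by
          have h := mul_le_norm_vPost_sub hσ1 hne hσ
          rw [← hρ, hρa] at h
          linarith [norm_sub_le (vPost v vs σ) v]
        rw [h0 _ hfar, h1 v hv, zero_sub, mul_neg_one, enorm_neg, ← ofReal_norm]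
        exact ENNReal.ofReal_le_ofReal ((hB σ hσ).trans (Real.le_norm_self _))
    _ ≤ _ := setLIntegral_le_lintegral _ _

theorem exists_pos_norm_le_of_integral_pos {g : V3 → ℝ} (hg0 : ∀ v, 0 ≤ g v)
    (hg : 0 < ∫ v, g v) : ∃ r > (0 : ℝ), ∃ᵐ v, ‖v‖ ≤ r ∧ 0 < g v := by
  by_contra! h
  have hall : ∀ᵐ v, ∀ n : ℕ, ‖v‖ ≤ (n : ℝ) + 1 → g v ≤ 0 :=
    ae_all_iff.2 fun n => h (n + 1) (by positivity)
  refine hg.ne' (integral_eq_zero_of_ae ?_)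
  filter_upwards [hall] with v hv
  obtain ⟨n, hn⟩ := exists_nat_ge ‖v‖
  exact le_antisymm (hv n (by linarith)) (hg0 v)

theorem HasWeakDerivV1.lintegral_closedBall_lt_top {α : Fin 3 → ℕ} {u h : V3 → ℝ}
    (H : HasWeakDerivV1 α u h) {R p : ℝ} (hR : 0 < R) (hp : p ≤ 0) :
    ∫⁻ v in Metric.closedBall 0 R, ENNReal.ofReal (|h v| * jap v ^ p) < ⊤ := by
  let φ : ContDiffBump (0 : V3) := ⟨R, 2 * R, hR, by linarith⟩
  have hφ : TestV φ := ⟨φ.contDiff, 2 * R, fun v hv =>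
    φ.zero_of_le_dist (by rwa [dist_zero_right])⟩
  refine lt_of_le_of_lt ?_ (H.2 φ hφ).1.hasFiniteIntegral
  refine (lintegral_mono_ae ?_).trans (setLIntegral_le_lintegral (Metric.closedBall 0 R) _)
  filter_upwards [ae_restrict_mem Metric.isClosed_closedBall.measurableSet] with v hv
  rw [φ.one_of_mem_closedBall hv, mul_one, ← ofReal_norm, Real.norm_eq_abs]
  exact ENNReal.ofReal_le_ofReal (mul_le_of_le_one_right (abs_nonneg _)
    (Real.rpow_le_one_of_one_le_of_nonpos (one_le_jap v) hp))

theorem mOrder_lt_of_lt {α β : Fin 3 → ℕ} (h : α < β) : mOrder α < mOrder β := by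
  obtain ⟨hle, i, hi⟩ := Pi.lt_def.1 h
  have h0 : α 0 ≤ β 0 := hle 0
  have h1 : α 1 ≤ β 1 := hle 1
  have h2 : α 2 ≤ β 2 := hle 2
  unfold mOrder
  fin_cases i <;> simp at hi <;> omega

/-- Theorem 1.3, part (2): failure of the Leibniz rule in `v`,
spatially homogeneous case. The family `D α` consists of the weak derivatives
`∂^α_v g` for `α ≤ 𝔑₂`; the conclusion produces `χ ∈ C_c^∞(ℝ³)` with `0 ≤ χ ≤ 1`
such that `Σ_{α+β=𝔑₂} B(v-v_*,σ) ∂^α_v g(v_*) ∂^β_v g(v) (χ(v')-χ(v))` is not absolutely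
integrable on `ℝ³×ℝ³×S²`; this is precisely the failure of the Leibniz-rule identity
for `∂^{𝔑₂}_v Q(g,g)`, whose right-hand side would be the (absolutely convergent)
integral of this function. -/
theorem statement4 (γ s : ℝ) (hs0 : 0 < s) (hs1 : s < 1) (hγ1 : -2 * s - 1 < γ)
    (hγ0 : γ < 0) (hγ2s : γ + 2 * s < 0) (b : ℝ → ℝ) (hb : AngularKernel s b)
    (ℓ : ℝ) (hℓ : 3 ≤ ℓ)
    (g : V3 → ℝ) (hg0 : ∀ v, 0 ≤ g v) (hgmeas : Measurable g)
    (hgL : wLp 2 ℓ (toC1 g) < ⊤) (hgpos : 0 < ∫ v, g v)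
    (N₂ : Fin 3 → ℕ) (hN₂ : 5 ≤ mOrder N₂)
    (D : (Fin 3 → ℕ) → V3 → ℝ) (hD0 : D 0 = g)
    (hDder : ∀ α ≤ N₂, HasWeakDerivV1 α g (D α))
    (hDfin : ∀ α : Fin 3 → ℕ, mOrder α < mOrder N₂ →
      (∫⁻ v, ENNReal.ofReal (|D α v| * jap v ^ (γ + 2 * s))) < ⊤)
    (hDinf : (∫⁻ v, ENNReal.ofReal (|D N₂ v| * jap v ^ (γ + 2 * s))) = ⊤) :
    ∃ χ : V3 → ℝ,
      ContDiff ℝ ((⊤ : ℕ∞) : WithTop ℕ∞) χ ∧ HasCompactSupport χ ∧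
      (∀ v, 0 ≤ χ v) ∧ (∀ v, χ v ≤ 1) ∧
      ¬ Integrable (fun p : V3 × V3 × V3 =>
          ∑ α ∈ Finset.Iic N₂, Bker γ b (p.1 - p.2.1) p.2.2 *
            D α p.2.1 * D (N₂ - α) p.1 * (χ (vPost p.1 p.2.1 p.2.2) - χ p.1))
        (volume.prod (volume.prod sphMeas)) := by
  obtain ⟨r, hr, hfreq⟩ := exists_pos_norm_le_of_integral_pos hg0 hgpos
  let χ : ContDiffBump (0 : V3) := ⟨r, 2 * r, hr, by linarith⟩
  refine ⟨χ, χ.contDiff, χ.hasCompactSupport, fun _ => χ.nonneg, fun _ => χ.le_one, fun hint => ?_⟩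
  have hχ1 : ∀ w, ‖w‖ ≤ r → χ w = 1 := fun w hw =>
    χ.one_of_mem_closedBall (mem_closedBall_zero_iff.2 hw)
  have hχ0 : ∀ w, 2 * r ≤ ‖w‖ → χ w = 0 := fun w hw =>
    χ.zero_of_le_dist (by rwa [dist_zero_right])
  obtain ⟨c, hc, hlow⟩ := exists_le_lintegral_Bker hb hs0 hγ2s hr
  obtain ⟨v, ⟨hvr, hgv⟩, hv⟩ := (hfreq.and_eventually hint.prod_right_ae).exists
  set p := γ + 2 * s
  let F : V3 → ℝ := fun vs => ∑ α ∈ Finset.Iic N₂, D α vs * D (N₂ - α) v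
  have hDm : ∀ α ∈ Finset.Iic N₂, Measurable (D α) := fun α hα =>
    (hDder α (Finset.mem_Iic.1 hα)).1
  have hjm : Measurable fun vs : V3 => ENNReal.ofReal (jap vs ^ p) :=
    (measurable_jap.pow_const p).ennreal_ofReal
  let A : Set V3 := {vs | 100 * r ≤ ‖vs‖}
  have hAm : MeasurableSet A := measurableSet_le measurable_const measurable_norm
  have hfin := hv.hasFiniteIntegral
  rw [hasFiniteIntegral_iff_enorm, lintegral_prod _ hv.aestronglyMeasurable.enorm] at hfin
  have hF : ∫⁻ vs in A, ‖F vs‖ₑ * ENNReal.ofReal (jap vs ^ p) < ⊤ := by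
    have hle : ENNReal.ofReal c * ∫⁻ vs in A, ‖F vs‖ₑ * ENNReal.ofReal (jap vs ^ p) < ⊤ := by
      refine lt_of_le_of_lt ?_ hfin
      refine (lintegral_const_mul_le _ _).trans ?_
      refine (lintegral_mono_ae ?_).trans (setLIntegral_le_lintegral A _)
      filter_upwards [ae_restrict_mem hAm] with vs hvs
      calc ENNReal.ofReal c * (‖F vs‖ₑ * ENNReal.ofReal (jap vs ^ p))
          = ‖F vs‖ₑ * ENNReal.ofReal (c * jap vs ^ p) := by
            rw [ENNReal.ofReal_mul hc.le]; ring
        _ ≤ ‖F vs‖ₑ * ∫⁻ σ, ‖Bker γ b (v - vs) σ * (χ (vPost v vs σ) - χ v)‖ₑ ∂sphMeas := by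
            gcongr
            exact hlow χ v vs hχ1 hχ0 hvr hvs
        _ ≤ _ := by
            refine (lintegral_const_mul_le _ _).trans (lintegral_mono fun σ => ?_)
            rw [← enorm_mul]
            refine le_of_eq (congrArg _ ?_)
            rw [Finset.sum_mul]
            exact Finset.sum_congr rfl fun α _ => by ring
    exact ENNReal.lt_top_of_mul_ne_top_right hle.ne (by simpa using hc)
  have hrest : ∀ α ∈ Finset.Iio N₂,
      ∫⁻ vs in A, ‖D α vs * D (N₂ - α) v‖ₑ * ENNReal.ofReal (jap vs ^ p) < ⊤ := by
    intro α hα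
    have h := hDfin α (mOrder_lt_of_lt (Finset.mem_Iio.1 hα))
    refine (setLIntegral_le_lintegral A _).trans_lt ?_
    have heq : ∀ vs, ‖D α vs * D (N₂ - α) v‖ₑ * ENNReal.ofReal (jap vs ^ p) =
        ‖D (N₂ - α) v‖ₑ * ENNReal.ofReal (|D α vs| * jap vs ^ p) := fun vs => by
      rw [ENNReal.ofReal_mul (abs_nonneg _), enorm_mul, ← Real.enorm_eq_ofReal_abs]
      ring
    simp_rw [heq]
    rw [lintegral_const_mul' _ _ enorm_ne_top]
    exact ENNReal.mul_lt_top enorm_lt_top h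
  have htop : ∫⁻ vs in A, ‖D N₂ vs * g v‖ₑ * ENNReal.ofReal (jap vs ^ p) < ⊤ := by
    have hpt : ∀ vs, ‖D N₂ vs * g v‖ₑ * ENNReal.ofReal (jap vs ^ p) ≤
        ‖F vs‖ₑ * ENNReal.ofReal (jap vs ^ p) +
          ∑ α ∈ Finset.Iio N₂, ‖D α vs * D (N₂ - α) v‖ₑ * ENNReal.ofReal (jap vs ^ p) := by
      intro vs
      have hFeq : D N₂ vs * g v = F vs - ∑ α ∈ Finset.Iio N₂, D α vs * D (N₂ - α) v := by
        simp only [F]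
        rw [← Finset.Iio_insert, Finset.sum_insert (by simp), tsub_self, hD0]
        ring
      rw [← Finset.sum_mul, ← add_mul, hFeq]
      gcongr
      exact enorm_sub_le.trans (by gcongr; exact enorm_sum_le _ _)
    have hm : ∀ α ∈ Finset.Iio N₂, Measurable fun vs =>
        ‖D α vs * D (N₂ - α) v‖ₑ * ENNReal.ofReal (jap vs ^ p) := fun α hα =>
      ((hDm α (Finset.mem_Iic.2 (Finset.mem_Iio.1 hα).le)).mul_const _).enorm.mul hjm
    refine (lintegral_mono hpt).trans_lt ?_
    rw [lintegral_add_right _ (Finset.measurable_fun_sum _ hm), lintegral_finsetSum _ hm]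
    exact ENNReal.add_lt_top.2 ⟨hF, ENNReal.sum_lt_top.2 hrest⟩
  have hfar : ∫⁻ vs in A, ENNReal.ofReal (|D N₂ vs| * jap vs ^ p) < ⊤ := by
    have heq : ∀ vs, ‖D N₂ vs * g v‖ₑ * ENNReal.ofReal (jap vs ^ p) =
        ‖g v‖ₑ * ENNReal.ofReal (|D N₂ vs| * jap vs ^ p) := fun vs => by
      rw [ENNReal.ofReal_mul (abs_nonneg _), enorm_mul, ← Real.enorm_eq_ofReal_abs]
      ring
    simp_rw [heq] at htop
    rw [lintegral_const_mul' _ _ enorm_ne_top] at htop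
    exact ENNReal.lt_top_of_mul_ne_top_right htop.ne (by simpa using hgv.ne')
  have hnear := (hDder N₂ le_rfl).lintegral_closedBall_lt_top (R := 100 * r) (p := p)
    (by positivity) hγ2s.le
  have hcover : (univ : Set V3) ⊆ A ∪ Metric.closedBall 0 (100 * r) := fun w _ =>
    (le_total (100 * r) ‖w‖).imp id mem_closedBall_zero_iff.2
  have hsum := (lintegral_mono_set (μ := volume) hcover).trans
    (lintegral_union_le (fun vs => ENNReal.ofReal (|D N₂ vs| * jap vs ^ p)) _ _)
  rw [setLIntegral_univ, hDinf] at hsum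
  exact (hsum.trans_lt (ENNReal.add_lt_top.2 ⟨hfar, hnear⟩)).false
end
end

section
/- (Nonemptiness of the sets of typical rough and slowly decaying data.) For every ℓ > 0, a > 0, n ≥ 0 and every ε ∈ (0,1), the sets R_sd(ℓ; ε, a) and H^n_sd(ℓ; ε, a) are nonempty. -/
open MeasureTheory Real Filter Function Set
open scoped ENNReal Topology RealInnerProductSpace FourierTransform

noncomputable section

theorem eX_eq_prod (m : Fin 3 → ℤ) (x : X3) :
    eX m x = ∏ i, Complex.exp (2 * π * Complex.I * m i * x i) := by
  rw [eX, ← Complex.exp_sum]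
  congr 1
  push_cast
  rw [Finset.mul_sum, Finset.sum_mul]
  exact Finset.sum_congr rfl fun i _ => by ring

theorem norm_eX (m : Fin 3 → ℤ) (x : X3) : ‖eX m x‖ = 1 := by
  rw [eX, Complex.norm_exp_ofReal_mul_I]

theorem eX_add (m q : Fin 3 → ℤ) (x : X3) : eX (m + q) x = eX m x * eX q x := by
  simp only [eX_eq_prod, ← Finset.prod_mul_distrib, ← Complex.exp_add]
  exact Finset.prod_congr rfl fun i _ => by congr 1; push_cast [Pi.add_apply]; ring

theorem eX_neg (m : Fin 3 → ℤ) (x : X3) : eX (-m) x = (eX m x)⁻¹ := by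
  refine eq_inv_of_mul_eq_one_left ?_
  rw [← eX_add]
  simp [eX]

theorem eX_add_int (m k : Fin 3 → ℤ) (x : X3) : eX m (x + fun i => (k i : ℝ)) = eX m x := by
  simp only [eX_eq_prod]
  refine Finset.prod_congr rfl fun i _ => Complex.exp_eq_exp_iff_exists_int.2 ⟨m i * k i, ?_⟩
  push_cast [Pi.add_apply]
  ring

@[fun_prop]
theorem continuous_eX (m : Fin 3 → ℤ) : Continuous (eX m) := by
  unfold eX
  fun_prop

theorem integral_exp_two_pi_int (k : ℤ) :
    ∫ t : ℝ in Set.Icc 0 1, Complex.exp (2 * π * Complex.I * k * t) = if k = 0 then 1 else 0 := by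
  split_ifs with hk
  · simp [hk]
  · have hc : (2 * π * Complex.I * k : ℂ) ≠ 0 := by simp [hk, Real.pi_ne_zero]
    rw [integral_Icc_eq_integral_Ioc, ← intervalIntegral.integral_of_le zero_le_one,
      integral_exp_mul_complex hc]
    have : Complex.exp (2 * π * Complex.I * k) = 1 :=
      Complex.exp_eq_one_iff.2 ⟨k, by ring⟩
    simp [this]

theorem integral_cube_eX (m : Fin 3 → ℤ) :
    ∫ x in cube, eX m x = if m = 0 then 1 else 0 := by
  have hcube : cube = Set.univ.pi fun _ : Fin 3 => Set.Icc (0 : ℝ) 1 := by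
    ext x
    simp [cube, Set.mem_Icc, Pi.le_def]
  simp_rw [eX_eq_prod]
  rw [hcube, volume_pi, Measure.restrict_pi_pi,
    integral_fintype_prod_eq_prod
      (f := fun i (t : ℝ) => Complex.exp (2 * π * Complex.I * m i * t))]
  simp_rw [integral_exp_two_pi_int]
  rw [Finset.prod_ite_zero]
  simp [funext_iff]

/-- Fourier coefficient at `q` of `x ↦ 1 + cos (2π m·x)`. -/
def cosCoeff (m q : Fin 3 → ℤ) : ℂ :=
  (if q = 0 then 1 else 0) + ((if q = m then 1 else 0) + (if q = -m then 1 else 0)) / 2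

/-- The datum `(1 + cos (2π m(v)·x)) g(v)`, whose oscillation in `x` depends on `v`. -/
def oscData (m : V3 → Fin 3 → ℤ) (g : V3 → ℝ) : X3 → V3 → ℝ :=
  fun x v => (1 + (eX (m v) x).re) * g v

theorem Fx_oscData (m : V3 → Fin 3 → ℤ) (g : V3 → ℝ) (q : Fin 3 → ℤ) (v : V3) :
    Fx (toC (oscData m g)) q v = cosCoeff (m v) q * g v := by
  have hre (x : X3) : (((eX (m v) x).re : ℝ) : ℂ) = (eX (m v) x + eX (-m v) x) / 2 := by
    rw [Complex.re_eq_add_conj, eX_neg, Complex.inv_eq_conj (norm_eX _ _)]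
  have hint (k : Fin 3 → ℤ) : IntegrableOn (eX k) cube :=
    (continuous_eX k).continuousOn.integrableOn_compact isCompact_Icc
  have key (x : X3) : (eX q x)⁻¹ * toC (oscData m g) x v =
      (eX (-q) x + (eX (m v - q) x + eX (-m v - q) x) / 2) * g v := by
    simp only [toC, oscData, Complex.ofReal_mul, Complex.ofReal_add, Complex.ofReal_one, hre,
      sub_eq_add_neg, eX_add, ← eX_neg q]
    ring
  have hint2 : IntegrableOn (fun x => (eX (m v - q) x + eX (-m v - q) x) / 2) cube :=
    ((hint _).add (hint _)).div_const 2
  simp only [Fx, key]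
  rw [integral_mul_const, integral_add (hint _) hint2,
    integral_div, integral_add (hint _) (hint _)]
  simp only [integral_cube_eX, cosCoeff, neg_eq_zero, sub_eq_zero]
  simp only [eq_comm]

theorem norm_cosCoeff_le (m q : Fin 3 → ℤ) : ‖cosCoeff m q‖ ≤ 2 := by
  unfold cosCoeff
  split_ifs <;> norm_num

theorem cosCoeff_eq_zero {m q : Fin 3 → ℤ} (h : q ∉ ({0, m, -m} : Finset (Fin 3 → ℤ))) :
    cosCoeff m q = 0 := by
  simp only [Finset.mem_insert, Finset.mem_singleton, not_or] at h
  simp [cosCoeff, h]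

theorem cosCoeff_self {m : Fin 3 → ℤ} (hm : m ≠ 0) : cosCoeff m m = 1 / 2 := by
  simp [cosCoeff, hm, self_eq_neg]

theorem one_le_japZ (m : Fin 3 → ℤ) : 1 ≤ japZ m := by
  rw [japZ, Real.one_le_sqrt]
  have := Finset.sum_nonneg fun (i : Fin 3) (_ : i ∈ Finset.univ) => sq_nonneg (m i : ℝ)
  linarith

theorem continuous_jap : Continuous jap := by unfold jap; fun_prop

theorem tsum_cosCoeff_le (m : Fin 3 → ℤ) {n : ℝ} (hn : 0 ≤ n) :
    ∑' q, ENNReal.ofReal (japZ q ^ (2 * n)) * ‖cosCoeff m q‖ₑ ^ 2 ≤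
      12 * ENNReal.ofReal (japZ m ^ (2 * n)) := by
  have hc (q) : ‖cosCoeff m q‖ₑ ^ 2 ≤ 4 := by
    have : ‖cosCoeff m q‖ₑ ≤ 2 := by
      rw [← ofReal_norm]
      exact (ENNReal.ofReal_le_ofReal (norm_cosCoeff_le m q)).trans (by simp)
    calc _ ≤ (2 : ℝ≥0∞) ^ 2 := by gcongr
      _ = 4 := by norm_num
  have hneg : japZ (-m) = japZ m := by simp [japZ]
  have h0 : japZ 0 = 1 := by simp [japZ]
  rw [tsum_eq_sum (s := {0, m, -m}) fun q hq => by simp [cosCoeff_eq_zero hq]]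
  calc _ ≤ ∑ q ∈ ({0, m, -m} : Finset (Fin 3 → ℤ)), ENNReal.ofReal (japZ m ^ (2 * n)) * 4 := by
        refine Finset.sum_le_sum fun q hq => mul_le_mul' (ENNReal.ofReal_le_ofReal ?_) (hc q)
        simp only [Finset.mem_insert, Finset.mem_singleton] at hq
        rcases hq with rfl | rfl | rfl
        · rw [h0, Real.one_rpow]
          exact Real.one_le_rpow (one_le_japZ m) (by positivity)
        · exact le_rfl
        · rw [hneg]
    _ ≤ (3 : ℕ) • (ENNReal.ofReal (japZ m ^ (2 * n)) * 4) := by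
        rw [Finset.sum_const]
        gcongr
        exact Finset.card_le_three
    _ = _ := by
        rw [nsmul_eq_mul]
        push_cast
        ring

theorem wLp_two_sq (l : ℝ) (f : V3 → ℂ) :
    wLp 2 l f ^ 2 = ∫⁻ v, ENNReal.ofReal (jap v ^ l) ^ 2 * ‖f v‖ₑ ^ 2 := by
  have h := eLpNorm_nnreal_pow_eq_lintegral (μ := (volume : Measure V3)) (p := 2)
    (f := fun v => jap v ^ l • f v) two_ne_zero
  simp only [NNReal.coe_ofNat, ENNReal.coe_ofNat, ENNReal.rpow_ofNat] at h
  rw [wLp, h]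
  refine lintegral_congr fun v => ?_
  rw [enorm_smul, mul_pow, Real.enorm_of_nonneg]
  exact Real.rpow_nonneg (zero_le_one.trans (one_le_jap v)) _

theorem oscData_nonneg {m : V3 → Fin 3 → ℤ} {g : V3 → ℝ} (hg : ∀ v, 0 ≤ g v) (x : X3) (v : V3) :
    0 ≤ oscData m g x v := by
  refine mul_nonneg ?_ (hg v)
  have := (abs_le.1 ((Complex.abs_re_le_norm _).trans_eq (norm_eX (m v) x))).1
  linarith

theorem measurable_oscData {m : V3 → Fin 3 → ℤ} {g : V3 → ℝ} (hm : Measurable m)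
    (hg : Measurable g) : Measurable fun p : X3 × V3 => oscData m g p.1 p.2 := by
  have h : Measurable fun p : X3 × (Fin 3 → ℤ) => (eX p.2 p.1).re :=
    measurable_from_prod_countable_left fun k =>
      (Complex.continuous_re.comp (continuous_eX k)).measurable
  exact (measurable_const.add (h.comp (measurable_fst.prodMk (hm.comp measurable_snd)))).mul
    (hg.comp measurable_snd)

theorem oscData_periodic (m : V3 → Fin 3 → ℤ) (g : V3 → ℝ) (k : Fin 3 → ℤ) (x : X3) (v : V3) :
    oscData m g (x + fun i => (k i : ℝ)) v = oscData m g x v := by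
  simp [oscData, eX_add_int]

theorem hxL2Sq_oscData_lt_top {m : V3 → Fin 3 → ℤ} {g : V3 → ℝ} (hm : Measurable m)
    (hg : Measurable g) {n l : ℝ} (hn : 0 ≤ n)
    (h : ∫⁻ v, ENNReal.ofReal (japZ (m v) ^ (2 * n)) *
      (ENNReal.ofReal (jap v ^ l) ^ 2 * ‖g v‖ₑ ^ 2) < ⊤) :
    hxL2Sq n l (toC (oscData m g)) < ⊤ := by
  have hj : Measurable fun v => ENNReal.ofReal (jap v ^ l) :=
    (continuous_jap.measurable.pow_const l).ennreal_ofReal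
  have hmc (q) : Measurable fun v => cosCoeff (m v) q :=
    (measurable_of_countable fun k : Fin 3 → ℤ => cosCoeff k q).comp hm
  have hmj : Measurable fun v => ENNReal.ofReal (japZ (m v) ^ (2 * n)) :=
    (measurable_of_countable fun k : Fin 3 → ℤ => ENNReal.ofReal (japZ k ^ (2 * n))).comp hm
  unfold hxL2Sq hxNSq
  simp only [wLp_two_sq, Fx_oscData]
  simp_rw [← lintegral_const_mul' _ _ ENNReal.ofReal_ne_top]
  rw [← lintegral_tsum fun q => by
    have := hmc q
    fun_prop]
  calc _ ≤ ∫⁻ v, 12 * (ENNReal.ofReal (japZ (m v) ^ (2 * n)) *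
          (ENNReal.ofReal (jap v ^ l) ^ 2 * ‖g v‖ₑ ^ 2)) := by
        refine lintegral_mono fun v => ?_
        have e (q) : ENNReal.ofReal (japZ q ^ (2 * n)) *
            (ENNReal.ofReal (jap v ^ l) ^ 2 * ‖cosCoeff (m v) q * (g v : ℂ)‖ₑ ^ 2) =
            ENNReal.ofReal (japZ q ^ (2 * n)) * ‖cosCoeff (m v) q‖ₑ ^ 2 *
              (ENNReal.ofReal (jap v ^ l) ^ 2 * ‖g v‖ₑ ^ 2) := by
          have : ‖(g v : ℂ)‖ₑ = ‖g v‖ₑ := by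
            rw [← ofReal_norm, Complex.norm_real, ofReal_norm]
          rw [enorm_mul, this]
          ring
        simp only [e]
        rw [ENNReal.tsum_mul_right, ← mul_assoc 12]
        exact mul_le_mul_left (tsum_cosCoeff_le (m v) hn) _
    _ < ⊤ := by
        rw [lintegral_const_mul' _ _ (by norm_num)]
        exact ENNReal.mul_lt_top (by norm_num) h

theorem linfxL2_oscData_lt_top {m : V3 → Fin 3 → ℤ} {g : V3 → ℝ} {l : ℝ}
    (h : ∫⁻ v, ENNReal.ofReal (jap v ^ l) ^ 2 * ‖g v‖ₑ ^ 2 < ⊤) :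
    linfxL2 l (oscData m g) < ⊤ := by
  have hb (x : X3) : wLp 2 l (fun v => (oscData m g x v : ℂ)) ^ 2 ≤
      4 * ∫⁻ v, ENNReal.ofReal (jap v ^ l) ^ 2 * ‖g v‖ₑ ^ 2 := by
    rw [wLp_two_sq, ← lintegral_const_mul' _ _ (by norm_num)]
    refine lintegral_mono fun v => ?_
    have h2 : ‖(oscData m g x v : ℂ)‖ₑ ≤ 2 * ‖g v‖ₑ := by
      rw [← ofReal_norm, Complex.norm_real, ofReal_norm, oscData, enorm_mul]
      gcongr
      rw [← ofReal_norm]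
      have := abs_le.1 ((Complex.abs_re_le_norm _).trans_eq (norm_eX (m v) x))
      exact (ENNReal.ofReal_le_ofReal (abs_le.2 ⟨by linarith, by linarith⟩ :
        ‖1 + (eX (m v) x).re‖ ≤ 2)).trans (by simp)
    calc _ ≤ ENNReal.ofReal (jap v ^ l) ^ 2 * (2 * ‖g v‖ₑ) ^ 2 := by gcongr
      _ = _ := by ring
  set S := ∫⁻ v, ENNReal.ofReal (jap v ^ l) ^ 2 * ‖g v‖ₑ ^ 2
  have hS : 4 * S < ⊤ := ENNReal.mul_lt_top (by norm_num) h
  refine lt_of_le_of_lt (essSup_le_of_ae_le (1 + 4 * S) (ae_of_all _ fun x => ?_))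
    (ENNReal.add_lt_top.2 ⟨by norm_num, hS⟩)
  rcases le_total (wLp 2 l fun v => (oscData m g x v : ℂ)) 1 with h1 | h1
  · exact h1.trans le_self_add
  · exact ((le_self_pow h1 two_ne_zero).trans (hb x)).trans le_add_self

theorem rsdSum_eq_top {φv : V3 → ℝ} {ℓ ε a n : ℝ} {f : X3 → V3 → ℝ} {c : ℝ≥0∞} (hc : c ≠ 0)
    {j l : ℕ → ℕ} (hl : Injective l) (h1 : ∀ p, 1 ≤ j p) (hjl : ∀ p, a * j p < l p)
    (hf : ∀ p, c ≤ ENNReal.ofReal ((2 : ℝ) ^ ((2 * ℓ * a + 2 * n * (1 - ε) + ε) * j p)) *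
      eLpNorm (Fdy φv (j p) (Pdy φv (l p) (Fx (toC f) (mIdx ε (j p) true)))) 2 volume ^ 2) :
    rsdSum φv ℓ ε a n f = ⊤ := by
  rw [eq_top_iff, ← ENNReal.tsum_const_eq_top_of_ne_zero (α := ℕ) hc]
  unfold rsdSum
  rw [← ENNReal.tsum_prod]
  have hinj : Injective fun p => (j p, l p) := fun p q h => hl (Prod.ext_iff.1 h).2
  refine le_trans (ENNReal.tsum_le_tsum fun p => ?_)
    (ENNReal.tsum_comp_le_tsum_of_injective hinj _)
  simp only [h1 p, hjl p, and_self, if_true]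
  exact (hf p).trans (by gcongr; exact le_self_add)

theorem SchwartzMap.eLpNorm_fourier_two {V : Type*} [NormedAddCommGroup V] [InnerProductSpace ℝ V]
    [FiniteDimensional ℝ V] [MeasurableSpace V] [BorelSpace V] (f : SchwartzMap V ℂ) :
    eLpNorm (𝓕 f : SchwartzMap V ℂ) 2 volume = eLpNorm f 2 volume := by
  have h := SchwartzMap.norm_fourier_toL2_eq f
  rw [SchwartzMap.norm_toLp, SchwartzMap.norm_toLp] at h
  have h1 : eLpNorm (𝓕 f : SchwartzMap V ℂ) 2 volume ≠ ⊤ :=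
    (SchwartzMap.memLp (𝓕 f : SchwartzMap V ℂ) 2 volume).eLpNorm_ne_top
  have h2 : eLpNorm f 2 volume ≠ ⊤ := (f.memLp 2 volume).eLpNorm_ne_top
  exact (ENNReal.toReal_eq_toReal_iff' h1 h2).1 h

theorem eLpNorm_fourierInv_eq {V : Type*} [NormedAddCommGroup V] [InnerProductSpace ℝ V]
    [FiniteDimensional ℝ V] [MeasurableSpace V] [BorelSpace V] {G : V → ℂ}
    (hG : HasCompactSupport G) (hG' : ContDiff ℝ ((⊤ : ℕ∞) : WithTop ℕ∞) G) :
    eLpNorm (𝓕⁻ G) 2 volume = eLpNorm G 2 volume := by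
  have h := (𝓕⁻ (hG.toSchwartzMap hG') : SchwartzMap V ℂ).eLpNorm_fourier_two
  rw [FourierTransform.fourier_fourierInv_eq, SchwartzMap.fourierInv_coe] at h
  exact h.symm

theorem hasCompactSupport_comp_two_rpow_smul {φv : V3 → ℝ} (hφ : HasCompactSupport φv) (j : ℕ) :
    HasCompactSupport fun ξ => φv ((2 : ℝ) ^ (-(j : ℝ)) • ξ) :=
  hφ.comp_smul (by positivity)

theorem continuous_fourier {f : V3 → ℂ} (hf : Integrable f) : Continuous (𝓕 f) :=
  VectorFourier.fourierIntegral_continuous Real.continuous_fourierChar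
    (by exact continuous_inner) hf

theorem continuous_fourierInv {f : V3 → ℂ} (hf : Integrable f) : Continuous (𝓕⁻ f) := by
  have : 𝓕⁻ f = fun w => 𝓕 f (-w) := funext fun w => Real.fourierInv_eq_fourier_neg f w
  rw [this]
  exact (continuous_fourier hf).comp continuous_neg

theorem integrable_cutoff_mul_fourier {φv : V3 → ℝ} (hφ : HasCompactSupport φv)
    (hφc : Continuous φv) (j : ℕ) {f : V3 → ℂ} (hf : Integrable f) :
    Integrable fun ξ => (φv ((2 : ℝ) ^ (-(j : ℝ)) • ξ) : ℂ) * 𝓕 f ξ := by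
  have := continuous_fourier hf
  refine Continuous.integrable_of_hasCompactSupport (by fun_prop) ?_
  exact ((hasCompactSupport_comp_two_rpow_smul hφ j).comp_left Complex.ofReal_zero).mul_right

theorem continuous_Fdy {φv : V3 → ℝ} (hφ : HasCompactSupport φv)
    (hφc : Continuous φv) (j : ℕ) {f : V3 → ℂ} (hf : Integrable f) :
    Continuous (Fdy φv j f) :=
  continuous_fourierInv (integrable_cutoff_mul_fourier hφ hφc j hf)

theorem fourier_const_mul (c : ℂ) (f : V3 → ℂ) : 𝓕 (fun v => c * f v) = fun ξ => c * 𝓕 f ξ :=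
  VectorFourier.fourierIntegral_const_smul 𝐞 volume (innerₗ V3) f c

theorem fourierInv_const_mul (c : ℂ) (f : V3 → ℂ) :
    𝓕⁻ (fun v => c * f v) = fun ξ => c * 𝓕⁻ f ξ :=
  VectorFourier.fourierIntegral_const_smul 𝐞 volume (-innerₗ V3) f c

theorem Fdy_const_mul (φv : V3 → ℝ) (j : ℕ) (c : ℂ) (f : V3 → ℂ) :
    Fdy φv j (fun v => c * f v) = fun v => c * Fdy φv j f v := by
  unfold Fdy
  rw [fourier_const_mul, ← fourierInv_const_mul]
  congr 1
  ext ξ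
  ring

theorem Fdy_add {φv : V3 → ℝ} (hφ : HasCompactSupport φv) (hφc : Continuous φv) (j : ℕ)
    {f g : V3 → ℂ} (hf : Integrable f) (hg : Integrable g) :
    Fdy φv j (f + g) = Fdy φv j f + Fdy φv j g := by
  have h1 : 𝓕 (f + g) = 𝓕 f + 𝓕 g :=
    VectorFourier.fourierIntegral_add Real.continuous_fourierChar (by exact continuous_inner) hf hg
  have h2 {F G : V3 → ℂ} (hF : Integrable F) (hG : Integrable G) : 𝓕⁻ (F + G) = 𝓕⁻ F + 𝓕⁻ G :=
    VectorFourier.fourierIntegral_add Real.continuous_fourierChar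
      (by exact continuous_inner.neg) hF hG
  unfold Fdy
  rw [h1, ← h2 (integrable_cutoff_mul_fourier hφ hφc j hf)
    (integrable_cutoff_mul_fourier hφ hφc j hg)]
  congr 1
  ext ξ
  simp [mul_add]

theorem enorm_fourier_modulate_translate (b : V3 → ℂ) (v₀ η ξ : V3) :
    ‖𝓕 (fun v => b (v - v₀) * 𝐞 (inner ℝ v η)) ξ‖ₑ = ‖𝓕 b (ξ - η)‖ₑ := by
  have h : 𝓕 (fun v => b (v - v₀) * 𝐞 (inner ℝ v η)) ξ =
      (𝐞 (-inner ℝ v₀ (ξ - η)) : ℂ) * 𝓕 b (ξ - η) := by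
    rw [Real.fourier_eq, Real.fourier_eq, ← integral_const_mul]
    refine Eq.trans ?_ (integral_sub_right_eq_self
      (fun v => (𝐞 (-inner ℝ v₀ (ξ - η)) : ℂ) * (𝐞 (-inner ℝ v (ξ - η)) • b v)) v₀)
    refine integral_congr_ae (ae_of_all _ fun v => ?_)
    simp only [Circle.smul_def, smul_eq_mul, inner_sub_left, inner_sub_right]
    rw [mul_left_comm, ← mul_assoc (𝐞 _ : ℂ) (𝐞 _ : ℂ), ← Circle.coe_mul, ← Circle.coe_mul,
      ← AddChar.map_add_eq_mul, ← AddChar.map_add_eq_mul, mul_comm]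
    congr 3
    ring
  rw [h, ← ofReal_norm, ← ofReal_norm, norm_mul, Circle.norm_coe, one_mul]

theorem two_rpow_neg_smul_sub_mem_ball {ξ₀ ξ : V3} {r : ℝ} (k : ℕ)
    (h : ξ - (2 : ℝ) ^ (k : ℝ) • ξ₀ ∈ Metric.ball 0 r) :
    (2 : ℝ) ^ (-(k : ℝ)) • ξ ∈ Metric.ball ξ₀ r := by
  rw [mem_ball_zero_iff] at h
  have e : (2 : ℝ) ^ (-(k : ℝ)) • ξ - ξ₀ = (2 : ℝ) ^ (-(k : ℝ)) • (ξ - (2 : ℝ) ^ (k : ℝ) • ξ₀) := by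
    rw [smul_sub, smul_smul, ← Real.rpow_add two_pos, neg_add_cancel, Real.rpow_zero, one_smul]
  rw [mem_ball_iff_norm, e, norm_smul, Real.norm_of_nonneg (by positivity)]
  refine lt_of_le_of_lt ?_ h
  exact mul_le_of_le_one_left (norm_nonneg _)
    (Real.rpow_le_one_of_one_le_of_nonpos one_le_two (by simp))

/-- A lower bound, uniform in the scale and in the position, for the frequency localization of
modulated translates of a bump. -/
theorem le_eLpNorm_Fdy_modulate {φv : V3 → ℝ} (hφ : HasCompactSupport φv)
    (hφc : ContDiff ℝ ((⊤ : ℕ∞) : WithTop ℕ∞) φv) {ξ₀ : V3} {r δ : ℝ}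
    (hδ : ∀ ξ ∈ Metric.ball ξ₀ r, δ ≤ φv ξ) (hδ0 : 0 < δ) {b : V3 → ℂ} (hb : HasCompactSupport b)
    (hbc : ContDiff ℝ ((⊤ : ℕ∞) : WithTop ℕ∞) b) (j : ℕ) (v₀ : V3) :
    ENNReal.ofReal δ * eLpNorm (𝓕 b) 2 (volume.restrict (Metric.ball 0 r)) ≤
      eLpNorm (Fdy φv j fun v => b (v - v₀) * 𝐞 (inner ℝ v ((2 : ℝ) ^ (j : ℝ) • ξ₀))) 2
        volume := by
  set η := (2 : ℝ) ^ (j : ℝ) • ξ₀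
  set B : V3 → ℂ := fun v => b (v - v₀) * 𝐞 (inner ℝ v η)
  have hB : HasCompactSupport B :=
    (hb.comp_homeomorph (Homeomorph.subRight v₀)).mul_right
  have hBc : ContDiff ℝ ((⊤ : ℕ∞) : WithTop ℕ∞) B := by
    have : ContDiff ℝ ((⊤ : ℕ∞) : WithTop ℕ∞) fun v : V3 => (𝐞 (inner ℝ v η) : ℂ) := by
      simp only [Real.fourierChar_apply]
      exact ((Complex.ofRealCLM.contDiff.comp (contDiff_const.mul
        (contDiff_id.inner ℝ contDiff_const))).mul contDiff_const).cexp
    exact (hbc.comp (contDiff_id.sub contDiff_const)).mul this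
  have hF : ContDiff ℝ ((⊤ : ℕ∞) : WithTop ℕ∞) (𝓕 B) :=
    (𝓕 (hB.toSchwartzMap hBc)).smooth _
  rw [Fdy, eLpNorm_fourierInv_eq]
  · have hmp := (measurePreserving_sub_right (volume : Measure V3) η).restrict_preimage
      (s := Metric.ball 0 r) Metric.isOpen_ball.measurableSet
    have hbint : Integrable b := hbc.continuous.integrable_of_hasCompactSupport hb
    rw [← eLpNorm_comp_measurePreserving
      (continuous_fourier hbint).aestronglyMeasurable hmp]
    refine le_trans ?_ (eLpNorm_mono_measure _
      (Measure.restrict_le_self (s := (fun x => x - η) ⁻¹' Metric.ball 0 r)))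
    have hδn : ENNReal.ofReal δ = ‖(δ : ℂ)‖ₑ := by
      rw [← ofReal_norm, Complex.norm_real, Real.norm_of_nonneg hδ0.le]
    rw [hδn, ← eLpNorm_const_smul]
    refine eLpNorm_mono_enorm_ae ?_
    filter_upwards [ae_restrict_mem (Metric.isOpen_ball.measurableSet.preimage
      (measurable_id.sub_const η))] with ξ hξ
    rw [Pi.smul_apply, enorm_smul, enorm_mul, enorm_fourier_modulate_translate, ← hδn,
      Function.comp_apply]
    gcongr
    rw [← ofReal_norm, Complex.norm_real]
    exact ENNReal.ofReal_le_ofReal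
      ((hδ _ (two_rpow_neg_smul_sub_mem_ball j hξ)).trans (le_abs_self _))
  · exact ((hasCompactSupport_comp_two_rpow_smul hφ j).comp_left Complex.ofReal_zero).mul_right
  · exact (Complex.ofRealCLM.contDiff.comp (hφc.comp (contDiff_const_smul _))).mul hF

theorem eLpNorm_fourier_ball_ne_zero {b : V3 → ℝ} (hb : HasCompactSupport b)
    (hbc : Continuous b) (hb0 : ∀ v, 0 ≤ b v) (hb1 : b 0 ≠ 0) {r : ℝ} (hr : 0 < r) :
    eLpNorm (𝓕 fun v => (b v : ℂ)) 2 (volume.restrict (Metric.ball 0 r)) ≠ 0 := by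
  have hint : Integrable fun v => (b v : ℂ) :=
    (hbc.integrable_of_hasCompactSupport hb).ofReal
  have hF := continuous_fourier hint
  intro h
  rw [eLpNorm_eq_zero_iff hF.aestronglyMeasurable two_ne_zero] at h
  have h0 := Measure.eqOn_open_of_ae_eq h Metric.isOpen_ball hF.continuousOn
    continuousOn_const (Metric.mem_ball_self hr)
  have hpos := hbc.integral_pos_of_hasCompactSupport_nonneg_nonzero (μ := volume) hb hb0 hb1
  rw [Real.fourier_eq] at h0
  simp only [inner_zero_right, neg_zero, AddChar.map_zero_eq_one, one_smul, Pi.zero_apply] at h0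
  rw [integral_complex_ofReal, Complex.ofReal_eq_zero] at h0
  exact ne_of_gt hpos h0

/-- Among the positive and negative parts of the real and imaginary parts of a modulated bump, one
has a frequency localization that is not small. -/
theorem exists_weight_le_eLpNorm_Fdy {φv : V3 → ℝ} (hφ : HasCompactSupport φv)
    (hφc : ContDiff ℝ ((⊤ : ℕ∞) : WithTop ℕ∞) φv) {ξ₀ : V3} {r δ : ℝ} (hr : 0 < r)
    (hδ : ∀ ξ ∈ Metric.ball ξ₀ r, δ ≤ φv ξ) (hδ0 : 0 < δ) {b : V3 → ℝ} (hb : HasCompactSupport b)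
    (hbc : ContDiff ℝ ((⊤ : ℕ∞) : WithTop ℕ∞) b) (hb0 : ∀ v, 0 ≤ b v) (hb1 : b 0 ≠ 0) :
    ∃ c : ℝ≥0∞, c ≠ 0 ∧ ∀ (j : ℕ) (v₀ : V3), ∃ w : V3 → ℝ, Measurable w ∧ (∀ v, 0 ≤ w v) ∧
      (∀ v, w v ≤ 1) ∧
      c ≤ eLpNorm (Fdy φv j fun v => ((b (v - v₀) * w v : ℝ) : ℂ)) 2 volume := by
  set c₀ := ENNReal.ofReal δ *
    eLpNorm (𝓕 fun v => (b v : ℂ)) 2 (volume.restrict (Metric.ball 0 r)) with hc₀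
  have hc₀0 : c₀ ≠ 0 := mul_ne_zero (by simpa using hδ0)
    (eLpNorm_fourier_ball_ne_zero hb hbc.continuous hb0 hb1 hr)
  refine ⟨c₀ / 4, by simp [hc₀0], fun j v₀ => ?_⟩
  by_contra! hlt
  have hle := le_eLpNorm_Fdy_modulate hφ hφc hδ hδ0 (hb.comp_left Complex.ofReal_zero)
    (Complex.ofRealCLM.contDiff.comp hbc) j v₀
  set η := (2 : ℝ) ^ (j : ℝ) • ξ₀
  set e : V3 → ℂ := fun v => 𝐞 (inner ℝ v η) with he
  have hec : Continuous e := by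
    simp only [he, Real.fourierChar_apply]
    fun_prop
  have hen (v) : ‖e v‖ = 1 := Circle.norm_coe _
  have hbint : Integrable fun v => b (v - v₀) :=
    (hbc.continuous.integrable_of_hasCompactSupport hb).comp_sub_right v₀
  set u : (V3 → ℝ) → V3 → ℂ := fun w v => ((b (v - v₀) * w v : ℝ) : ℂ) with hu
  have huint {w : V3 → ℝ} (hw : Continuous w) (hw1 : ∀ v, w v ≤ 1) (hw0 : ∀ v, 0 ≤ w v) :
      Integrable (u w) :=
    (hbint.mul_bdd (c := 1) hw.aestronglyMeasurable
      (ae_of_all _ fun v => by rw [Real.norm_of_nonneg (hw0 v)]; exact hw1 v)).ofReal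
  set w₁ : V3 → ℝ := fun v => max (e v).re 0
  set w₂ : V3 → ℝ := fun v => max (-(e v).re) 0
  set w₃ : V3 → ℝ := fun v => max (e v).im 0
  set w₄ : V3 → ℝ := fun v => max (-(e v).im) 0
  have hre (v) := abs_le.1 ((Complex.abs_re_le_norm (e v)).trans_eq (hen v))
  have him (v) := abs_le.1 ((Complex.abs_im_le_norm (e v)).trans_eq (hen v))
  have hc₁ : Continuous w₁ := by fun_prop
  have hc₂ : Continuous w₂ := by fun_prop
  have hc₃ : Continuous w₃ := by fun_prop
  have hc₄ : Continuous w₄ := by fun_prop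
  have h0₁ (v) : 0 ≤ w₁ v := le_max_right _ _
  have h0₂ (v) : 0 ≤ w₂ v := le_max_right _ _
  have h0₃ (v) : 0 ≤ w₃ v := le_max_right _ _
  have h0₄ (v) : 0 ≤ w₄ v := le_max_right _ _
  have h1₁ (v) : w₁ v ≤ 1 := max_le (hre v).2 zero_le_one
  have h1₂ (v) : w₂ v ≤ 1 := max_le (by linarith [(hre v).1]) zero_le_one
  have h1₃ (v) : w₃ v ≤ 1 := max_le (him v).2 zero_le_one
  have h1₄ (v) : w₄ v ≤ 1 := max_le (by linarith [(him v).1]) zero_le_one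
  have i₁ := huint hc₁ h1₁ h0₁
  have i₂ := huint hc₂ h1₂ h0₂
  have i₃ := huint hc₃ h1₃ h0₃
  have i₄ := huint hc₄ h1₄ h0₄
  have hsplit : (fun v => (b (v - v₀) : ℂ) * e v) =
      (u w₁ + fun v => (-1) * u w₂ v) +
        ((fun v => Complex.I * u w₃ v) + fun v => (-Complex.I) * u w₄ v) := by
    ext v
    have hp (t : ℝ) : max t 0 - max (-t) 0 = t := max_zero_sub_eq_self t
    have h₁ : e v = (w₁ v - w₂ v : ℝ) + (w₃ v - w₄ v : ℝ) * Complex.I := by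
      rw [hp, hp, Complex.re_add_im]
    simp only [Pi.add_apply, hu]
    rw [h₁]
    push_cast
    ring
  have hn (z : ℂ) (hz : ‖z‖ = 1) (w : V3 → ℝ) :
      eLpNorm (Fdy φv j fun v => z * u w v) 2 volume = eLpNorm (Fdy φv j (u w)) 2 volume := by
    rw [Fdy_const_mul]
    refine eLpNorm_congr_norm_ae (ae_of_all _ fun v => ?_)
    rw [norm_mul, hz, one_mul]
  have hφc' := hφc.continuous
  have hadd {f g : V3 → ℂ} (hf : Integrable f) (hg : Integrable g) :
      eLpNorm (Fdy φv j (f + g)) 2 volume ≤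
        eLpNorm (Fdy φv j f) 2 volume + eLpNorm (Fdy φv j g) 2 volume := by
    rw [Fdy_add hφ hφc' j hf hg]
    exact eLpNorm_add_le (continuous_Fdy hφ hφc' j hf).aestronglyMeasurable
      (continuous_Fdy hφ hφc' j hg).aestronglyMeasurable one_le_two
  have hfinal : c₀ < c₀ / 4 + c₀ / 4 + (c₀ / 4 + c₀ / 4) := by
    calc c₀ ≤ eLpNorm (Fdy φv j fun v => (b (v - v₀) : ℂ) * e v) 2 volume := hle
      _ ≤ (eLpNorm (Fdy φv j (u w₁)) 2 volume + eLpNorm (Fdy φv j (u w₂)) 2 volume) +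
          (eLpNorm (Fdy φv j (u w₃)) 2 volume + eLpNorm (Fdy φv j (u w₄)) 2 volume) := by
        rw [hsplit, ← hn (-1) (by simp) w₂, ← hn Complex.I (by simp) w₃,
          ← hn (-Complex.I) (by simp) w₄]
        exact (hadd (i₁.add (i₂.const_mul _)) ((i₃.const_mul _).add (i₄.const_mul _))).trans
          (add_le_add (hadd i₁ (i₂.const_mul _)) (hadd (i₃.const_mul _) (i₄.const_mul _)))
      _ < _ := ENNReal.add_lt_add
        (ENNReal.add_lt_add (hlt _ hc₁.measurable h0₁ h1₁) (hlt _ hc₂.measurable h0₂ h1₂))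
        (ENNReal.add_lt_add (hlt _ hc₃.measurable h0₃ h1₃) (hlt _ hc₄.measurable h0₄ h1₄))
  refine hfinal.ne' ?_
  have h4 : c₀ / 4 + c₀ / 4 + (c₀ / 4 + c₀ / 4) = c₀ / 4 * 4 := by ring
  rw [h4, ENNReal.div_mul_cancel (by norm_num) (by norm_num)]

theorem DyadicPartition.exists_ball {ψv φv : V3 → ℝ} (hdy : DyadicPartition ψv φv) :
    ∃ (ξ₀ : V3) (r δ : ℝ), 0 < r ∧ 0 < δ ∧ ∀ ξ ∈ Metric.ball ξ₀ r, δ ≤ φv ξ := by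
  obtain ⟨ξ₀, h⟩ : ∃ ξ₀, φv ξ₀ ≠ 0 := by
    by_contra! h0
    have h := hdy.partition (EuclideanSpace.single 0 2)
    rw [hdy.supp_psi _ (by rw [PiLp.norm_single]; norm_num)] at h
    simp [h0] at h
  have hpos : 0 < φv ξ₀ := lt_of_le_of_ne (hdy.nonneg_phi _) (Ne.symm h)
  have hev := (hdy.smooth_phi.continuous.tendsto ξ₀).eventually
    (lt_mem_nhds (half_lt_self hpos))
  obtain ⟨r, hr, hball⟩ := Metric.eventually_nhds_iff_ball.1 hev
  exact ⟨ξ₀, r, φv ξ₀ / 2, hr, half_pos hpos, fun ξ hξ => (hball ξ hξ).le⟩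

theorem DyadicPartition.hasCompactSupport_phi {ψv φv : V3 → ℝ} (hdy : DyadicPartition ψv φv) :
    HasCompactSupport φv := by
  refine HasCompactSupport.intro (isCompact_closedBall (0 : V3) (8 / 3)) fun ξ hξ => ?_
  rw [mem_closedBall_zero_iff, not_le] at hξ
  exact hdy.supp_phi ξ (Or.inr hξ)

/-- The index `p` of the annulus `3/4 · 4^p ≤ |v| ≤ 8/3 · 4^p` containing `v`, if there is one. -/
def annulusIdx (v : V3) : ℕ := Nat.log 2 ⌊4 / 3 * ‖v‖⌋₊ / 2

theorem measurable_annulusIdx : Measurable annulusIdx := by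
  have h : Measurable fun v : V3 => ⌊4 / 3 * ‖v‖⌋₊ :=
    Nat.measurable_floor.comp (measurable_norm.const_mul _)
  exact (measurable_of_countable fun k : ℕ => Nat.log 2 k / 2).comp h

theorem DyadicPartition.norm_mem_of_ne_zero {ψv φv : V3 → ℝ} (hdy : DyadicPartition ψv φv)
    {k : ℕ} {v : V3} (h : φv ((2 : ℝ) ^ (-(k : ℝ)) • v) ≠ 0) :
    3 / 4 * 2 ^ k ≤ ‖v‖ ∧ ‖v‖ ≤ 8 / 3 * 2 ^ k := by
  have h' := mt (hdy.supp_phi _) h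
  rw [not_or, not_lt, not_lt, norm_smul, Real.norm_of_nonneg (by positivity),
    Real.rpow_neg two_pos.le, Real.rpow_natCast, inv_mul_eq_div, le_div_iff₀ (by positivity),
    div_le_iff₀ (by positivity)] at h'
  exact h'

theorem DyadicPartition.annulusIdx_eq {ψv φv : V3 → ℝ} (hdy : DyadicPartition ψv φv)
    {p : ℕ} {v : V3} (h : φv ((2 : ℝ) ^ (-((2 * p : ℕ) : ℝ)) • v) ≠ 0) : annulusIdx v = p := by
  obtain ⟨h1, h2⟩ := hdy.norm_mem_of_ne_zero h
  have hR : (0 : ℝ) < 2 ^ (2 * p) := by positivity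
  have hlo : 2 ^ (2 * p) ≤ ⌊4 / 3 * ‖v‖⌋₊ := Nat.le_floor (by push_cast; linarith)
  have hhi : ⌊4 / 3 * ‖v‖⌋₊ < 2 ^ (2 * p + 2) := by
    rw [Nat.floor_lt (by positivity)]
    push_cast
    rw [pow_add]
    linarith
  have h3 : 2 * p ≤ Nat.log 2 ⌊4 / 3 * ‖v‖⌋₊ := Nat.le_log_of_pow_le one_lt_two hlo
  have hpos := Nat.two_pow_pos (2 * p)
  have h4 : Nat.log 2 ⌊4 / 3 * ‖v‖⌋₊ < 2 * p + 2 := Nat.log_lt_of_lt_pow (by omega) hhi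
  unfold annulusIdx
  omega

theorem japZ_mIdx_le {ε : ℝ} (hε : ε < 1) (j : ℕ) :
    japZ (mIdx ε j true) ≤ 2 ^ (1 + (1 - ε) * j) := by
  set x := (2 : ℝ) ^ ((1 - ε) * j) with hx
  have hx1 : 1 ≤ x :=
    Real.one_le_rpow one_le_two (mul_nonneg (sub_nonneg.2 hε.le) j.cast_nonneg)
  have h0 : (0 : ℝ) ≤ ⌊x⌋ := by exact_mod_cast Int.floor_nonneg.2 (zero_le_one.trans hx1)
  have h1 : (⌊x⌋ : ℝ) ≤ x := Int.floor_le x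
  rw [Real.rpow_add two_pos, Real.rpow_one, ← hx, japZ, Real.sqrt_le_left (by positivity)]
  simp only [mIdx, ← hx, Fin.sum_univ_three, if_true, if_neg (one_ne_zero : (1 : Fin 3) ≠ 0),
    if_neg (by decide : (2 : Fin 3) ≠ 0)]
  push_cast
  nlinarith

theorem mIdx_ne_zero {ε : ℝ} (hε : ε < 1) (j : ℕ) : mIdx ε j true ≠ 0 := by
  intro h
  have h0 := congrFun h 0
  have hx1 : (1 : ℝ) ≤ (2 : ℝ) ^ ((1 - ε) * j) :=
    Real.one_le_rpow one_le_two (mul_nonneg (sub_nonneg.2 hε.le) j.cast_nonneg)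
  have h1 : (1 : ℤ) ≤ ⌊(2 : ℝ) ^ ((1 - ε) * j)⌋ := Int.le_floor.2 (by simpa using hx1)
  simp only [mIdx, if_true, one_mul, Pi.zero_apply] at h0
  omega

theorem jap_le_of_norm_le {v : V3} {R : ℝ} (hR : 1 ≤ R) (h : ‖v‖ ≤ 8 / 3 * R) : jap v ≤ 4 * R := by
  rw [jap, Real.sqrt_le_left (by positivity)]
  nlinarith [norm_nonneg v]

/-- The largest `j` with `a * j < 2 * p` (for `0 < p`). -/
def shellFreq (a : ℝ) (p : ℕ) : ℕ := ⌈2 * p / a⌉₊ - 1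

theorem mul_shellFreq_lt {a : ℝ} (ha : 0 < a) {p : ℕ} (hp : 0 < p) :
    a * shellFreq a p < 2 * p := by
  have hx : 0 < 2 * p / a := by positivity
  have h1 := Nat.ceil_lt_add_one hx.le
  have h2 : 1 ≤ ⌈2 * p / a⌉₊ := Nat.ceil_pos.2 hx
  have h3 : (shellFreq a p : ℝ) < 2 * p / a := by
    rw [shellFreq, Nat.cast_sub h2, Nat.cast_one]
    linarith
  rwa [lt_div_iff₀ ha, mul_comm] at h3

theorem le_mul_shellFreq_add_one {a : ℝ} (ha : 0 < a) (p : ℕ) :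
    2 * p ≤ a * (shellFreq a p + 1) := by
  have h1 := Nat.le_ceil (2 * p / a)
  have h2 : (⌈2 * p / a⌉₊ : ℝ) ≤ shellFreq a p + 1 := by
    exact_mod_cast (by unfold shellFreq; omega : ⌈2 * p / a⌉₊ ≤ shellFreq a p + 1)
  rw [mul_comm a, ← div_le_iff₀ ha]
  exact h1.trans h2

theorem one_le_shellFreq {a : ℝ} (ha : 0 < a) {p : ℕ} (hp : a ≤ p) : 1 ≤ shellFreq a p := by
  have h1 : 1 < ⌈2 * p / a⌉₊ := by
    rw [Nat.lt_ceil, Nat.cast_one, lt_div_iff₀ ha]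
    linarith
  unfold shellFreq
  omega

theorem shell_weight_le {ℓ a ε n : ℝ} (hℓ : 0 < ℓ) (ha : 0 < a) (hn : 0 ≤ n) (hε : 0 < ε)
    {j p : ℕ} (hjp : 2 * p ≤ a * (j + 1)) {y z : ℝ} (hy0 : 0 ≤ y) (hy : y ≤ 4 * 2 ^ (2 * p))
    (hz0 : 0 ≤ z) (hz : z ≤ 2 ^ (1 + (1 - ε) * j)) :
    z ^ (2 * n) * (y ^ ℓ * 2 ^ (-((2 * ℓ * a + 2 * n * (1 - ε) + ε) / 2 * j))) ^ 2 ≤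
      2 ^ (2 * n + 2 * ℓ * (2 + a) + ε) * (2 ^ (-(2 * ε / a))) ^ p := by
  have hy' : y ≤ 2 ^ (2 + a * (j + 1)) := by
    refine hy.trans ?_
    have : (4 : ℝ) * 2 ^ (2 * p) = 2 ^ (2 + 2 * (p : ℝ)) := by
      rw [Real.rpow_add two_pos, ← Real.rpow_natCast]
      norm_num
    rw [this]
    exact Real.rpow_le_rpow_of_exponent_le one_le_two (by linarith)
  have h1 : z ^ (2 * n) ≤ 2 ^ ((1 + (1 - ε) * j) * (2 * n)) := by
    rw [Real.rpow_mul two_pos.le]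
    exact Real.rpow_le_rpow hz0 hz (by positivity)
  have h2 : y ^ ℓ ≤ 2 ^ ((2 + a * (j + 1)) * ℓ) := by
    rw [Real.rpow_mul two_pos.le]
    exact Real.rpow_le_rpow hy0 hy' hℓ.le
  calc _ ≤ (2 : ℝ) ^ ((1 + (1 - ε) * j) * (2 * n)) * (2 ^ ((2 + a * (j + 1)) * ℓ) *
        2 ^ (-((2 * ℓ * a + 2 * n * (1 - ε) + ε) / 2 * j))) ^ 2 := by gcongr
    _ = 2 ^ (2 * n + 2 * ℓ * (2 + a) - ε * j) := by
      rw [← Real.rpow_add two_pos, ← Real.rpow_mul_natCast two_pos.le, ← Real.rpow_add two_pos]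
      congr 1
      push_cast
      ring
    _ ≤ 2 ^ (2 * n + 2 * ℓ * (2 + a) + ε + -(2 * ε / a) * p) := by
      refine Real.rpow_le_rpow_of_exponent_le one_le_two ?_
      have : 2 * ε / a * p ≤ ε * (j + 1) := by
        rw [div_mul_eq_mul_div, div_le_iff₀ ha]
        nlinarith
      linarith
    _ = _ := by rw [Real.rpow_add two_pos, Real.rpow_mul_natCast two_pos.le]

/-- The profile: bumps `b` centred at `4^p ξ₀`, modulated by weights `w p`, with the factor
`φ(4^{-p}·)` of the phase localization divided out. -/
def shellProfile (φv b : V3 → ℝ) (w : ℕ → V3 → ℝ) (ξ₀ : V3) (A : ℕ → ℝ) (p : ℕ) (v : V3) : ℝ :=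
  A p * (b (v - (2 : ℝ) ^ ((2 * p : ℕ) : ℝ) • ξ₀) /
    φv ((2 : ℝ) ^ (-((2 * p : ℕ) : ℝ)) • v) * w p v)

theorem Pdy_Fx_shell {ψv φv : V3 → ℝ} (hdy : DyadicPartition ψv φv) {ξ₀ : V3} {r δ : ℝ}
    (hδ0 : 0 < δ) (hδ : ∀ ξ ∈ Metric.ball ξ₀ r, δ ≤ φv ξ) {b : V3 → ℝ}
    (hb : ∀ v, b v ≠ 0 → v ∈ Metric.ball 0 r) (w : ℕ → V3 → ℝ) (A : ℕ → ℝ)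
    {M : ℕ → Fin 3 → ℤ} (hM : ∀ p, M p ≠ 0) (p : ℕ) :
    Pdy φv (2 * p) (Fx (toC (oscData (fun v => M (annulusIdx v))
        fun v => shellProfile φv b w ξ₀ A (annulusIdx v) v)) (M p)) =
      fun v => ((A p / 2 : ℝ) : ℂ) *
        ((b (v - (2 : ℝ) ^ ((2 * p : ℕ) : ℝ) • ξ₀) * w p v : ℝ) : ℂ) := by
  ext v
  rw [Pdy, Fx_oscData]
  by_cases h : φv ((2 : ℝ) ^ (-((2 * p : ℕ) : ℝ)) • v) = 0
  · have hb0 : b (v - (2 : ℝ) ^ ((2 * p : ℕ) : ℝ) • ξ₀) = 0 := by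
      by_contra h1
      have := hδ _ (two_rpow_neg_smul_sub_mem_ball (2 * p) (hb _ h1))
      linarith
    rw [h, hb0]
    simp
  · simp only [hdy.annulusIdx_eq h]
    rw [cosCoeff_self (hM p), shellProfile]
    have h' : (φv ((2 : ℝ) ^ (-((2 * p : ℕ) : ℝ)) • v) : ℂ) ≠ 0 := by exact_mod_cast h
    push_cast at h' ⊢
    field_simp

theorem lintegral_lt_top_of_le_indicator_ball {F : ℕ → V3 → ℝ≥0∞} {K q r : ℝ} {v₀ : ℕ → V3}
    (hK : 0 ≤ K) (hq0 : 0 ≤ q) (hq1 : q < 1) (idx : V3 → ℕ)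
    (hF : ∀ p v, F p v ≤
      (Metric.ball (v₀ p) r).indicator (fun _ => ENNReal.ofReal (K * q ^ p)) v) :
    ∫⁻ v, F (idx v) v < ⊤ := by
  set Φ : ℕ → V3 → ℝ≥0∞ := fun p =>
    (Metric.ball (v₀ p) r).indicator fun _ => ENNReal.ofReal (K * q ^ p)
  calc ∫⁻ v, F (idx v) v ≤ ∫⁻ v, ∑' p, Φ p v :=
        lintegral_mono fun v => (hF (idx v) v).trans (ENNReal.le_tsum (f := fun p => Φ p v) (idx v))
    _ = ∑' p, ENNReal.ofReal (K * q ^ p) * volume (Metric.ball (0 : V3) r) := by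
      rw [lintegral_tsum fun p => (measurable_const.indicator measurableSet_ball).aemeasurable]
      refine tsum_congr fun p => ?_
      rw [lintegral_indicator_const measurableSet_ball, Measure.addHaar_ball_center]
    _ < ⊤ := by
      rw [ENNReal.tsum_mul_right, ← ENNReal.ofReal_tsum_of_nonneg (fun p => by positivity)
        ((summable_geometric_of_lt_one hq0 hq1).mul_left K)]
      exact ENNReal.mul_lt_top ENNReal.ofReal_lt_top measure_ball_lt_top

theorem measurable_shellProfile {φv b : V3 → ℝ} (hφ : Measurable φv) (hb : Measurable b)
    {w : ℕ → V3 → ℝ} (hw : ∀ p, Measurable (w p)) (ξ₀ : V3) (A : ℕ → ℝ) (p : ℕ) :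
    Measurable (shellProfile φv b w ξ₀ A p) :=
  (((hb.comp (measurable_id.sub_const _)).div
    (hφ.comp (measurable_id.const_smul ((2 : ℝ) ^ (-((2 * p : ℕ) : ℝ)))))).mul (hw p)).const_mul _

theorem DyadicPartition.shellProfile_weight_le {ψv φv : V3 → ℝ} (hdy : DyadicPartition ψv φv)
    {ℓ a ε n : ℝ} (hℓ : 0 < ℓ) (ha : 0 < a) (hn : 0 ≤ n) (hε : ε ∈ Set.Ioo (0 : ℝ) 1)
    {ξ₀ : V3} {r δ : ℝ} (hδ0 : 0 < δ) (hδ : ∀ ξ ∈ Metric.ball ξ₀ r, δ ≤ φv ξ) {b : V3 → ℝ}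
    (hb : ∀ v, b v ≠ 0 → v ∈ Metric.ball 0 r) (hb0 : ∀ v, 0 ≤ b v) (hb1 : ∀ v, b v ≤ 1)
    {w : ℕ → V3 → ℝ} (hw0 : ∀ p v, 0 ≤ w p v) (hw1 : ∀ p v, w p v ≤ 1) {A : ℕ → ℝ}
    (hA : ∀ p, A p = 2 ^ (-((2 * ℓ * a + 2 * n * (1 - ε) + ε) / 2 * shellFreq a p)))
    (p : ℕ) (v : V3) :
    ENNReal.ofReal (japZ (mIdx ε (shellFreq a p) true) ^ (2 * n)) *
        (ENNReal.ofReal (jap v ^ ℓ) ^ 2 * ‖shellProfile φv b w ξ₀ A p v‖ₑ ^ 2) ≤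
      (Metric.ball ((2 : ℝ) ^ ((2 * p : ℕ) : ℝ) • ξ₀) r).indicator (fun _ => ENNReal.ofReal
        (2 ^ (2 * n + 2 * ℓ * (2 + a) + ε) * (1 / δ) ^ 2 * (2 ^ (-(2 * ε / a))) ^ p)) v := by
  have hA0 : 0 < A p := by rw [hA]; positivity
  by_cases hbv : b (v - (2 : ℝ) ^ ((2 * p : ℕ) : ℝ) • ξ₀) = 0
  · rw [shellProfile, hbv]
    simp
  have hmem := hb _ hbv
  have hv : v ∈ Metric.ball ((2 : ℝ) ^ ((2 * p : ℕ) : ℝ) • ξ₀) r := by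
    rwa [mem_ball_zero_iff, ← mem_ball_iff_norm] at hmem
  have hφ := hδ _ (two_rpow_neg_smul_sub_mem_ball (2 * p) hmem)
  have hnorm := (hdy.norm_mem_of_ne_zero (hδ0.trans_le hφ).ne').2
  rw [Set.indicator_of_mem hv, shellProfile]
  set t := b (v - (2 : ℝ) ^ ((2 * p : ℕ) : ℝ) • ξ₀) /
    φv ((2 : ℝ) ^ (-((2 * p : ℕ) : ℝ)) • v) * w p v
  have ht0 : 0 ≤ t := mul_nonneg (div_nonneg (hb0 _) (hdy.nonneg_phi _)) (hw0 p v)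
  have ht1 : t ≤ 1 / δ := by
    rw [← mul_one (1 / δ)]
    exact mul_le_mul (div_le_div₀ zero_le_one (hb1 _) hδ0 hφ) (hw1 p v) (hw0 p v)
      (by positivity)
  have hjap : 0 ≤ jap v := zero_le_one.trans (one_le_jap v)
  have hjapZ : 0 ≤ japZ (mIdx ε (shellFreq a p) true) := zero_le_one.trans (one_le_japZ _)
  rw [← ofReal_norm, Real.norm_of_nonneg (by positivity), ← ENNReal.ofReal_pow (by positivity),
    ← ENNReal.ofReal_pow (by positivity), ← ENNReal.ofReal_mul (by positivity),
    ← ENNReal.ofReal_mul (by positivity)]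
  refine ENNReal.ofReal_le_ofReal ?_
  have hmain := shell_weight_le hℓ ha hn hε.1 (le_mul_shellFreq_add_one ha p)
    hjap (jap_le_of_norm_le (one_le_pow₀ one_le_two) hnorm) hjapZ (japZ_mIdx_le hε.2 _)
  rw [← hA] at hmain
  calc _ = japZ (mIdx ε (shellFreq a p) true) ^ (2 * n) * (jap v ^ ℓ * A p) ^ 2 * t ^ 2 := by ring
    _ ≤ 2 ^ (2 * n + 2 * ℓ * (2 + a) + ε) * (2 ^ (-(2 * ε / a))) ^ p * (1 / δ) ^ 2 :=
      mul_le_mul hmain (pow_le_pow_left₀ ht0 ht1 2) (by positivity) (by positivity)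
    _ = _ := by ring

theorem measurable_comp_index {α β : Type*} [MeasurableSpace α] [MeasurableSpace β] {G : ℕ → α → β}
    {idx : α → ℕ} (hidx : Measurable idx) (hG : ∀ p, Measurable (G p)) :
    Measurable fun v => G (idx v) v := by
  have h : Measurable fun x : ℕ × α => G x.1 x.2 := measurable_from_prod_countable_right hG
  exact h.comp (hidx.prodMk measurable_id)

theorem exists_oscData {ψv φv : V3 → ℝ} (hdy : DyadicPartition ψv φv) {ℓ a ε n : ℝ}
    (hℓ : 0 < ℓ) (ha : 0 < a) (hn : 0 ≤ n) (hε : ε ∈ Set.Ioo (0 : ℝ) 1) :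
    ∃ (m : V3 → Fin 3 → ℤ) (g : V3 → ℝ), Measurable m ∧ Measurable g ∧ (∀ v, 0 ≤ g v) ∧
      ∫⁻ v, ENNReal.ofReal (japZ (m v) ^ (2 * n)) *
        (ENNReal.ofReal (jap v ^ ℓ) ^ 2 * ‖g v‖ₑ ^ 2) < ⊤ ∧
      rsdSum φv ℓ ε a n (oscData m g) = ⊤ := by
  obtain ⟨ξ₀, r, δ, hr, hδ0, hδ⟩ := hdy.exists_ball
  let B : ContDiffBump (0 : V3) := ⟨r / 2, r, half_pos hr, half_lt_self hr⟩
  have hBsupp (v) (h : B v ≠ 0) : v ∈ Metric.ball 0 r := by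
    rw [← Function.mem_support, B.support_eq] at h
    exact h
  obtain ⟨c, hc, hw⟩ := exists_weight_le_eLpNorm_Fdy hdy.hasCompactSupport_phi hdy.smooth_phi hr hδ
    hδ0 B.hasCompactSupport B.contDiff (fun v => B.nonneg)
    (by rw [B.one_of_mem_closedBall (Metric.mem_closedBall_self B.rIn_pos.le)]; exact one_ne_zero)
  set j := shellFreq a
  set E := 2 * ℓ * a + 2 * n * (1 - ε) + ε with hE
  set A : ℕ → ℝ := fun p => 2 ^ (-(E / 2 * j p)) with hA
  have hA0 (p) : 0 < A p := by positivity
  choose w hwm hw0 hw1 hwc using fun p : ℕ => hw (j p) ((2 : ℝ) ^ ((2 * p : ℕ) : ℝ) • ξ₀)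
  set v₀ : ℕ → V3 := fun p => (2 : ℝ) ^ ((2 * p : ℕ) : ℝ) • ξ₀
  have hΦ := hdy.shellProfile_weight_le hℓ ha hn hε hδ0 hδ hBsupp (fun _ => B.nonneg)
    (fun _ => B.le_one) hw0 hw1 (A := A) fun _ => rfl
  set G := shellProfile φv B w ξ₀ A
  have hGm := measurable_shellProfile hdy.smooth_phi.continuous.measurable
    B.continuous.measurable hwm ξ₀ A
  have hG0 (p v) : 0 ≤ G p v := mul_nonneg (hA0 p).le
    (mul_nonneg (div_nonneg B.nonneg (hdy.nonneg_phi _)) (hw0 p v))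
  set M : ℕ → Fin 3 → ℤ := fun p => mIdx ε (j p) true
  have hq1 : (2 : ℝ) ^ (-(2 * ε / a)) < 1 := Real.rpow_lt_one_of_one_lt_of_neg one_lt_two
    (neg_neg_of_pos (div_pos (mul_pos two_pos hε.1) ha))
  refine ⟨fun v => M (annulusIdx v), fun v => G (annulusIdx v) v,
    (measurable_of_countable M).comp measurable_annulusIdx, ?_, fun v => hG0 _ v, ?_, ?_⟩
  · exact measurable_comp_index measurable_annulusIdx hGm
  · exact lintegral_lt_top_of_le_indicator_ball (by positivity) (by positivity) hq1 annulusIdx hΦ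
  · set p₀ := ⌈a⌉₊ + 1
    refine rsdSum_eq_top (c := ENNReal.ofReal (1 / 4) * c ^ 2)
      (mul_ne_zero (by simp) (pow_ne_zero 2 hc)) (j := fun p => j (p + p₀))
      (l := fun p => 2 * (p + p₀)) (fun x y h => by simpa using h)
      (fun p => one_le_shellFreq ha ?_) (fun p => ?_) fun p => ?_
    · have := Nat.le_ceil a
      push_cast [p₀]
      have : (0 : ℝ) ≤ p := p.cast_nonneg
      linarith
    · exact_mod_cast mul_shellFreq_lt ha (p := p + p₀) (by omega)
    · generalize p + p₀ = k
      rw [Pdy_Fx_shell hdy hδ0 hδ hBsupp w A (fun p => mIdx_ne_zero hε.2 (j p)), Fdy_const_mul]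
      have hsmul : (fun v => ((A k / 2 : ℝ) : ℂ) * Fdy φv (j k)
          (fun v => ((B (v - v₀ k) * w k v : ℝ) : ℂ)) v) =
          ((A k / 2 : ℝ) : ℂ) • Fdy φv (j k) fun v => ((B (v - v₀ k) * w k v : ℝ) : ℂ) := rfl
      rw [hsmul, eLpNorm_const_smul, mul_pow, ← mul_assoc]
      refine mul_le_mul' (le_of_eq ?_) (pow_le_pow_left₀ zero_le (hwc k) 2)
      rw [← ofReal_norm, Complex.norm_real, Real.norm_of_nonneg (by have := hA0 k; positivity),
        ← ENNReal.ofReal_pow (by have := hA0 k; positivity), ← ENNReal.ofReal_mul (by positivity)]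
      congr 1
      rw [div_pow, hA, ← Real.rpow_mul_natCast two_pos.le, ← mul_div_assoc,
        ← Real.rpow_add two_pos]
      have : E * j k + -(E / 2 * j k) * (2 : ℕ) = 0 := by push_cast; ring
      rw [this]
      norm_num

/-- Proposition 1.2: nonemptiness of `R_sd(ℓ;ε,a)` and `H^n_sd(ℓ;ε,a)`. -/
theorem statement9 (ψv φv : V3 → ℝ) (hdy : DyadicPartition ψv φv)
    (ℓ a ε n : ℝ) (hℓ : 0 < ℓ) (ha : 0 < a) (hn : 0 ≤ n) (hε : ε ∈ Set.Ioo (0 : ℝ) 1) :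
    (∃ f : X3 → V3 → ℝ, memRsd φv ℓ ε a f) ∧
      (∃ f : X3 → V3 → ℝ, memHnsd φv ℓ ε a n f) := by
  constructor
  · obtain ⟨m, g, hm, hg, hg0, hfin, hsum⟩ := exists_oscData hdy hℓ ha le_rfl hε
    exact ⟨oscData m g, oscData_nonneg hg0, measurable_oscData hm hg, oscData_periodic m g,
      linfxL2_oscData_lt_top (by simpa using hfin), hsum⟩
  · obtain ⟨m, g, hm, hg, hg0, hfin, hsum⟩ := exists_oscData hdy hℓ ha hn hε
    exact ⟨oscData m g, oscData_nonneg hg0, measurable_oscData hm hg, oscData_periodic m g,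
      hxL2Sq_oscData_lt_top hm hg hn hfin, hsum⟩
end
end

section
/- Let a > 0, ℓ > 0 and δ > 0. Then there exists a function f ∈ L²_ℓ(ℝ³) such that Σ_{j=1}^∞ Σ_{l∈ℤ, l>aj} 2^{2(ℓ+δ)aj} ‖F_j P_l f‖²_{L²(ℝ³)} = +∞. -/
open MeasureTheory Real Filter Function Set
open scoped ENNReal Topology RealInnerProductSpace FourierTransform

noncomputable section

theorem sq_eLpNorm_two {α : Type*} [MeasurableSpace α] (μ : Measure α) (F : α → ℂ) :
    eLpNorm F 2 μ ^ 2 = ∫⁻ x, ‖F x‖ₑ ^ 2 ∂μ := by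
  have h := eLpNorm_nnreal_pow_eq_lintegral (f := F) (μ := μ) (p := 2) two_ne_zero
  simpa using h

theorem lintegral_comp_smul_sub (F : V3 → ℝ≥0∞) {R : ℝ} (hR : 0 < R) (v₀ : V3) :
    ∫⁻ v, F (R • (v - v₀)) = ENNReal.ofReal ((R ^ 3)⁻¹) * ∫⁻ v, F v := by
  rw [lintegral_sub_right_eq_self (fun v => F (R • v)) v₀]
  have h := lintegral_map_equiv (μ := (volume : Measure V3)) F
    (Homeomorph.smulOfNeZero R hR.ne').toMeasurableEquiv
  have e : ((Homeomorph.smulOfNeZero R hR.ne').toMeasurableEquiv : V3 → V3) =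
      fun v => R • v := rfl
  rw [e] at h
  rw [← h, Measure.map_addHaar_smul _ hR.ne', lintegral_smul_measure]
  simp [abs_of_pos hR]

/-- The frequency localization commutes with translations and is covariant under dilations. -/
theorem fourierInv_mul_fourier_comp_smul_sub (m χ : V3 → ℂ) {R : ℝ} (hR : 0 < R)
    (v₀ : V3) (c : ℂ) (x : V3) :
    𝓕⁻ (fun ξ => m (R⁻¹ • ξ) * 𝓕 (fun v => c * χ (R • (v - v₀))) ξ) x =
      c * 𝓕⁻ (fun ξ => m ξ * 𝓕 χ ξ) (R • (x - v₀)) := by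
  have h1 : ∀ ξ : V3, 𝓕 (fun v => c * χ (R • (v - v₀))) (R • ξ) =
      ((R ^ 3)⁻¹ : ℝ) • (c * ((𝐞 (-⟪v₀, R • ξ⟫) : ℂ) * 𝓕 χ ξ)) := by
    intro ξ
    rw [fourier_eq, fourier_eq]
    rw [← integral_add_right_eq_self _ v₀]
    have h2 := Measure.integral_comp_smul (volume : Measure V3)
      (fun w => c * ((𝐞 (-⟪v₀, R • ξ⟫) : ℂ) * (𝐞 (-⟪w, ξ⟫) • χ w))) R
    simp only [finrank_euclideanSpace, Fintype.card_fin] at h2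
    rw [abs_of_pos (by positivity)] at h2
    rw [← integral_const_mul, ← integral_const_mul, ← h2]
    refine integral_congr_ae (Eventually.of_forall fun w => ?_)
    simp only [add_sub_cancel_right, inner_add_left, neg_add, AddChar.map_add_eq_mul,
      Circle.smul_def, Circle.coe_mul, smul_eq_mul, real_inner_smul_left, real_inner_smul_right]
    ring
  rw [fourierInv_eq, fourierInv_eq]
  have h3 := Measure.integral_comp_smul (volume : Measure V3)
    (fun ξ => 𝐞 ⟪ξ, x⟫ • (m (R⁻¹ • ξ) * 𝓕 (fun v => c * χ (R • (v - v₀))) ξ)) R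
  simp only [finrank_euclideanSpace, Fintype.card_fin] at h3
  rw [abs_of_pos (by positivity), eq_comm, inv_smul_eq_iff₀ (by positivity)] at h3
  rw [h3, ← integral_smul, ← integral_const_mul]
  refine integral_congr_ae (Eventually.of_forall fun ξ => ?_)
  have e : (𝐞 ⟪ξ, R • (x - v₀)⟫ : ℂ) = 𝐞 ⟪R • ξ, x⟫ * 𝐞 (-⟪v₀, R • ξ⟫) := by
    rw [← Circle.coe_mul, ← AddChar.map_add_eq_mul]
    congr 2
    rw [inner_smul_left, inner_smul_right, inner_smul_right, inner_sub_right,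
      real_inner_comm v₀ ξ]
    simp
    ring
  simp only [h1, Circle.smul_def, smul_eq_mul, e, inv_smul_smul₀ hR.ne',
    Complex.real_smul]
  push_cast
  have : (R : ℂ) ≠ 0 := by exact_mod_cast hR.ne'
  field_simp

/-- If the multiplier does not vanish at `p`, a modulated bump is not annihilated by the
corresponding frequency localization. -/
theorem exists_bump_not_annihilated (φv : V3 → ℝ)
    (hs : ContDiff ℝ ((⊤ : ℕ∞) : WithTop ℕ∞) φv) (hc : HasCompactSupport φv)
    (p : V3) (hp : φv p ≠ 0) (r : ℝ) (hr : 0 < r) :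
    ∃ χ : V3 → ℂ, Continuous χ ∧ HasCompactSupport χ ∧ (∀ w, r ≤ ‖w‖ → χ w = 0) ∧
      eLpNorm (𝓕⁻ fun ξ => (φv ξ : ℂ) * 𝓕 χ ξ) 2 volume ≠ 0 := by
  let b : ContDiffBump (0 : V3) := ⟨r / 2, r, by positivity, by linarith⟩
  let χ : V3 → ℂ := fun w => 𝐞 ⟪w, p⟫ * (b w : ℂ)
  have hχs : ContDiff ℝ ((⊤ : ℕ∞) : WithTop ℕ∞) χ := by
    refine ContDiff.mul ?_ (Complex.ofRealCLM.contDiff.comp b.contDiff)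
    simp only [Real.fourierChar_apply]
    refine Complex.contDiff_exp.comp (ContDiff.mul ?_ contDiff_const)
    refine Complex.ofRealCLM.contDiff.comp ?_
    exact contDiff_const.mul (contDiff_id.inner ℝ contDiff_const)
  have hχ0 : ∀ w, r ≤ ‖w‖ → χ w = 0 := fun w hw => by
    have : b w = 0 := b.zero_of_le_dist (by simpa using hw)
    simp [χ, this]
  have hχc : HasCompactSupport χ := by
    refine HasCompactSupport.intro (isCompact_closedBall (0 : V3) r) fun w hw => hχ0 w ?_
    simp at hw
    exact hw.le
  refine ⟨χ, hχs.continuous, hχc, hχ0, ?_⟩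
  let S : SchwartzMap V3 ℂ := hχc.toSchwartzMap hχs
  have hS : 𝓕 χ = (𝓕 S : SchwartzMap V3 ℂ) := by
    rw [SchwartzMap.fourier_coe]; rfl
  have hgs : ContDiff ℝ ((⊤ : ℕ∞) : WithTop ℕ∞) (fun ξ => (φv ξ : ℂ) * 𝓕 χ ξ) := by
    rw [hS]
    exact (Complex.ofRealCLM.contDiff.comp hs).mul ((𝓕 S : SchwartzMap V3 ℂ).smooth _)
  have hgc : HasCompactSupport (fun ξ => (φv ξ : ℂ) * 𝓕 χ ξ) :=
    HasCompactSupport.mul_right (hc.comp_left (g := fun t : ℝ => (t : ℂ)) Complex.ofReal_zero)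
  let T : SchwartzMap V3 ℂ := hgc.toSchwartzMap hgs
  have hT : (𝓕⁻ fun ξ => (φv ξ : ℂ) * 𝓕 χ ξ) = (𝓕⁻ T : SchwartzMap V3 ℂ) := by
    rw [SchwartzMap.fourierInv_coe]; rfl
  have hpos : 𝓕 χ p ≠ 0 := by
    have : 𝓕 χ p = ((∫ w, b w : ℝ) : ℂ) := by
      rw [fourier_eq, ← integral_complex_ofReal]
      refine integral_congr_ae (Eventually.of_forall fun w => ?_)
      simp only [χ, Circle.smul_def, smul_eq_mul, ← mul_assoc, ← Circle.coe_mul,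
        ← AddChar.map_add_eq_mul]
      simp
    rw [this]
    exact_mod_cast b.integral_pos.ne'
  rw [hT]
  intro h0
  rw [eLpNorm_eq_zero_iff (𝓕⁻ T : SchwartzMap V3 ℂ).continuous.aestronglyMeasurable
    two_ne_zero] at h0
  have h1 : 𝓕⁻ T = 0 := DFunLike.coe_injective <|
    (Continuous.ae_eq_iff_eq volume (𝓕⁻ T : SchwartzMap V3 ℂ).continuous continuous_zero).1 h0
  have h2 : T = 0 := by
    have h' : 𝓕 (𝓕⁻ T : SchwartzMap V3 ℂ) = T := FourierTransform.fourier_fourierInv_eq T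
    rw [← h', h1]
    exact map_zero (SchwartzMap.fourierTransformCLM ℂ)
  have h3 : T p = 0 := by rw [h2]; rfl
  have h4 : T p = (φv p : ℂ) * 𝓕 χ p := rfl
  rw [h4] at h3
  exact (mul_ne_zero (by exact_mod_cast hp) hpos) h3

theorem DyadicPartition.norm_bounds {ψv φv : V3 → ℝ} (hdy : DyadicPartition ψv φv) {l : ℕ}
    {v : V3} (h : φv ((2 : ℝ) ^ (-(l : ℝ)) • v) ≠ 0) :
    3 / 4 * (2 : ℝ) ^ (l : ℝ) ≤ ‖v‖ ∧ ‖v‖ ≤ 8 / 3 * (2 : ℝ) ^ (l : ℝ) := by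
  have h2 : (0 : ℝ) < 2 ^ (l : ℝ) := by positivity
  have hn : ‖(2 : ℝ) ^ (-(l : ℝ)) • v‖ = ‖v‖ / (2 : ℝ) ^ (l : ℝ) := by
    rw [norm_smul, Real.norm_of_nonneg (by positivity), rpow_neg zero_le_two]
    field_simp
  have h3 : ¬ (‖(2 : ℝ) ^ (-(l : ℝ)) • v‖ < 3 / 4 ∨ 8 / 3 < ‖(2 : ℝ) ^ (-(l : ℝ)) • v‖) :=
    fun h' => h (hdy.supp_phi _ h')
  rw [hn] at h3
  push Not at h3
  exact ⟨(le_div_iff₀ h2).1 h3.1, (div_le_iff₀ h2).1 h3.2⟩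

theorem DyadicPartition.not_overlap {ψv φv : V3 → ℝ} (hdy : DyadicPartition ψv φv) {l m : ℕ}
    (hlm : l + 2 ≤ m) {v : V3} (hl : φv ((2 : ℝ) ^ (-(l : ℝ)) • v) ≠ 0)
    (hm : φv ((2 : ℝ) ^ (-(m : ℝ)) • v) ≠ 0) : False := by
  have h1 := (hdy.norm_bounds hl).2
  have h2 := (hdy.norm_bounds hm).1
  have h3 : (2 : ℝ) ^ ((l : ℝ) + 2) ≤ (2 : ℝ) ^ (m : ℝ) :=
    rpow_le_rpow_of_exponent_le one_le_two (by exact_mod_cast hlm)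
  rw [rpow_add zero_lt_two] at h3
  norm_num at h3 h1 h2
  have h4 : (0 : ℝ) < 2 ^ l := by positivity
  linarith

theorem DyadicPartition.exists_ne_zero {ψv φv : V3 → ℝ} (hdy : DyadicPartition ψv φv) :
    ∃ p, φv p ≠ 0 := by
  by_contra! h
  have h1 := hdy.partition (EuclideanSpace.single 0 2)
  rw [hdy.supp_psi _ (by simp; norm_num)] at h1
  simp [h] at h1

theorem DyadicPartition.jap_rpow_le {ψv φv : V3 → ℝ} (hdy : DyadicPartition ψv φv) {l : ℕ}
    {v : V3} (h : φv ((2 : ℝ) ^ (-(l : ℝ)) • v) ≠ 0) {ℓ : ℝ} (hℓ : 0 ≤ ℓ) :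
    jap v ^ ℓ ≤ (4 * (2 : ℝ) ^ (l : ℝ)) ^ ℓ := by
  refine rpow_le_rpow (Real.sqrt_nonneg _) ?_ hℓ
  have h1 := (hdy.norm_bounds h).2
  have h2 : (1 : ℝ) ≤ 2 ^ (l : ℝ) := one_le_rpow one_le_two (by positivity)
  refine (Real.sqrt_le_left (by positivity)).2 ?_
  nlinarith [norm_nonneg v]

/-- Superposition of functions living in separated dyadic shells, normalized so that each
phase-space localization returns the prescribed function exactly. -/
def shellSum (φv : V3 → ℝ) (L : ℕ → ℕ) (h : ℕ → V3 → ℂ) (v : V3) : ℂ :=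
  ∑' k, h k v / φv ((2 : ℝ) ^ (-(L k : ℝ)) • v)

theorem shellSum_eq {ψv φv : V3 → ℝ} (hdy : DyadicPartition ψv φv) {L : ℕ → ℕ}
    (hL : ∀ k m, k < m → L k + 2 ≤ L m) {h : ℕ → V3 → ℂ}
    {k : ℕ} {v : V3} (hk : φv ((2 : ℝ) ^ (-(L k : ℝ)) • v) ≠ 0) :
    shellSum φv L h v = h k v / φv ((2 : ℝ) ^ (-(L k : ℝ)) • v) := by
  refine tsum_eq_single k fun m hm => ?_
  have : φv ((2 : ℝ) ^ (-(L m : ℝ)) • v) = 0 := by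
    by_contra h'
    rcases lt_or_gt_of_ne hm with h1 | h1
    · exact hdy.not_overlap (hL _ _ h1) h' hk
    · exact hdy.not_overlap (hL _ _ h1) hk h'
  simp only [this, Complex.ofReal_zero, div_zero]

theorem Pdy_shellSum {ψv φv : V3 → ℝ} (hdy : DyadicPartition ψv φv) {L : ℕ → ℕ}
    (hL : ∀ k m, k < m → L k + 2 ≤ L m) {h : ℕ → V3 → ℂ}
    (hh : ∀ k v, φv ((2 : ℝ) ^ (-(L k : ℝ)) • v) = 0 → h k v = 0) (k : ℕ) :
    Pdy φv (L k) (shellSum φv L h) = h k := by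
  funext v
  by_cases hk : φv ((2 : ℝ) ^ (-(L k : ℝ)) • v) = 0
  · simp only [Pdy, hk, hh k v hk, Complex.ofReal_zero, zero_mul]
  · have : (φv ((2 : ℝ) ^ (-(L k : ℝ)) • v) : ℂ) ≠ 0 := by exact_mod_cast hk
    rw [Pdy, shellSum_eq hdy hL hk]
    field_simp

theorem enorm_sq_jap_shellSum_le {ψv φv : V3 → ℝ} (hdy : DyadicPartition ψv φv) {L : ℕ → ℕ}
    (hL : ∀ k m, k < m → L k + 2 ≤ L m) {h : ℕ → V3 → ℂ}
    {c₀ : ℝ} (hc₀ : 0 < c₀)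
    (hh : ∀ k v, h k v ≠ 0 → c₀ ≤ φv ((2 : ℝ) ^ (-(L k : ℝ)) • v)) {ℓ : ℝ} (hℓ : 0 ≤ ℓ)
    (v : V3) :
    ‖jap v ^ ℓ • shellSum φv L h v‖ₑ ^ 2 ≤
      ∑' k, ENNReal.ofReal (((4 * (2 : ℝ) ^ (L k : ℝ)) ^ ℓ / c₀) ^ 2) * ‖h k v‖ₑ ^ 2 := by
  by_cases hv : ∃ k, h k v ≠ 0
  · obtain ⟨k, hk⟩ := hv
    have h1 := hh k v hk
    have h2 : φv ((2 : ℝ) ^ (-(L k : ℝ)) • v) ≠ 0 := (hc₀.trans_le h1).ne'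
    refine le_trans ?_ (ENNReal.le_tsum k)
    rw [shellSum_eq hdy hL h2, ENNReal.ofReal_pow (by positivity), ← mul_pow]
    gcongr
    rw [← ofReal_norm, ← ofReal_norm, ← ENNReal.ofReal_mul (by positivity)]
    refine ENNReal.ofReal_le_ofReal ?_
    have hj : 0 ≤ jap v := Real.sqrt_nonneg _
    rw [norm_smul, norm_div, Complex.norm_real, Real.norm_of_nonneg (by positivity),
      Real.norm_of_nonneg (hc₀.le.trans h1), mul_div_assoc', div_mul_eq_mul_div]
    exact div_le_div₀ (by positivity)
      (mul_le_mul_of_nonneg_right (hdy.jap_rpow_le h2 hℓ) (norm_nonneg _)) hc₀ h1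
  · push Not at hv
    simp [shellSum, hv]

theorem exists_separated_scales {a : ℝ} (ha : 0 < a) :
    ∃ (N : ℕ) (L : ℕ → ℕ), 0 < N ∧ (∀ k m, k < m → L k + 2 ≤ L m) ∧
      ∀ k, a * (N * (k + 1) : ℕ) < L k ∧ (L k : ℝ) ≤ a * (N * (k + 1) : ℕ) + 1 := by
  obtain ⟨N, hN⟩ := exists_nat_gt (2 / a)
  have hN2 : 2 < a * N := by rwa [div_lt_iff₀' ha] at hN
  have hN0 : 0 < N := by
    rcases Nat.eq_zero_or_pos N with h | h
    · simp [h] at hN2; linarith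
    · exact h
  refine ⟨N, fun k => ⌊a * (N * (k + 1) : ℕ)⌋₊ + 1, hN0, fun k m hkm => ?_, fun k => ⟨?_, ?_⟩⟩
  · have h1 : ⌊a * (N * (k + 1) : ℕ)⌋₊ + 2 ≤ ⌊a * (N * (m + 1) : ℕ)⌋₊ := by
      rw [← Nat.floor_add_ofNat (by positivity)]
      refine Nat.floor_le_floor ?_
      have : (k : ℝ) + 1 ≤ m := by exact_mod_cast hkm
      push_cast
      nlinarith
    change _ + 1 + 2 ≤ _ + 1
    omega
  · push_cast
    exact_mod_cast Nat.lt_floor_add_one _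
  · push_cast
    have := Nat.floor_le (a := a * (N * (k + 1) : ℕ)) (by positivity)
    push_cast at this
    linarith

/-- Lemma 2.6: existence of `f ∈ L²_ℓ` with divergent localized sum
`Σ_{j≥1} Σ_{l>aj} 2^{2(ℓ+δ)aj} ‖F_j P_l f‖²_{L²} = +∞`. -/
theorem statement10 (ψv φv : V3 → ℝ) (hdy : DyadicPartition ψv φv)
    (a ℓ δ : ℝ) (ha : 0 < a) (hℓ : 0 < ℓ) (hδ : 0 < δ) :
    ∃ f : V3 → ℂ, wLp 2 ℓ f < ⊤ ∧
      (∑' j : ℕ, ∑' l : ℕ, if 1 ≤ j ∧ a * j < l then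
          ENNReal.ofReal ((2 : ℝ) ^ (2 * (ℓ + δ) * a * j)) *
            eLpNorm (Fdy φv j (Pdy φv l f)) 2 volume ^ 2
        else 0) = ⊤ := by
  obtain ⟨p, hp⟩ := hdy.exists_ne_zero
  have hp0 : 0 < φv p := lt_of_le_of_ne (hdy.nonneg_phi p) hp.symm
  obtain ⟨c₀, hc₀, hcp⟩ := exists_between hp0
  obtain ⟨r, hr, hball⟩ := Metric.eventually_nhds_iff.1
    ((hdy.smooth_phi.continuous.tendsto p).eventually (lt_mem_nhds hcp))
  obtain ⟨χ, hχc, hχs, hχ0, hχK⟩ := exists_bump_not_annihilated φv hdy.smooth_phi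
    hdy.hasCompactSupport_phi p hp r hr
  obtain ⟨N, L, hN, hL, haL⟩ := exists_separated_scales ha
  set J : ℕ → ℕ := fun k => N * (k + 1) with hJ
  let e : ℕ → ℝ := fun k => 3 / 2 * J k - ℓ * L k - δ * a * J k
  let h : ℕ → V3 → ℂ := fun k v => (((2 : ℝ) ^ e k : ℝ) : ℂ) *
    χ ((2 : ℝ) ^ (J k : ℝ) • (v - (2 : ℝ) ^ (L k : ℝ) • p))
  have hh : ∀ k v, h k v ≠ 0 → c₀ ≤ φv ((2 : ℝ) ^ (-(L k : ℝ)) • v) := by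
    intro k v hk
    refine (hball ?_).le
    have h1 : ‖(2 : ℝ) ^ (J k : ℝ) • (v - (2 : ℝ) ^ (L k : ℝ) • p)‖ < r := by
      by_contra! h'
      exact hk (by simp only [h, hχ0 _ h', mul_zero])
    have h2 : (2 : ℝ) ^ (-(L k : ℝ)) • v - p =
        (2 : ℝ) ^ (-(L k : ℝ)) • (v - (2 : ℝ) ^ (L k : ℝ) • p) := by
      rw [smul_sub, smul_smul, ← rpow_add zero_lt_two]
      simp
    rw [dist_eq_norm, h2]
    refine lt_of_le_of_lt ?_ h1
    rw [norm_smul, norm_smul, Real.norm_of_nonneg (by positivity),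
      Real.norm_of_nonneg (by positivity)]
    gcongr
    · exact one_le_two
    · have : (0 : ℝ) ≤ L k := by positivity
      have : (0 : ℝ) ≤ J k := by positivity
      linarith
  have hh0 : ∀ k v, φv ((2 : ℝ) ^ (-(L k : ℝ)) • v) = 0 → h k v = 0 := by
    intro k v hk
    by_contra h'
    have := hh k v h'
    linarith
  have hpow : ∀ k, ((2 : ℝ) ^ e k) ^ 2 * (((2 : ℝ) ^ (J k : ℝ)) ^ 3)⁻¹ =
      (2 : ℝ) ^ (-2 * ℓ * L k - 2 * δ * a * J k) := by
    intro k
    rw [← rpow_natCast, ← rpow_natCast, ← rpow_mul zero_le_two, ← rpow_mul zero_le_two,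
      ← rpow_neg zero_le_two, ← rpow_add zero_lt_two]
    congr 1
    simp only [e]
    push_cast
    ring
  have hscale : ∀ k (F : V3 → ℂ), ∫⁻ v, ‖(((2 : ℝ) ^ e k : ℝ) : ℂ) *
      F ((2 : ℝ) ^ (J k : ℝ) • (v - (2 : ℝ) ^ (L k : ℝ) • p))‖ₑ ^ 2 =
      ENNReal.ofReal ((2 : ℝ) ^ (-2 * ℓ * L k - 2 * δ * a * J k)) * eLpNorm F 2 volume ^ 2 := by
    intro k F
    simp only [enorm_mul, mul_pow]
    rw [lintegral_const_mul' _ _ (by simp),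
      lintegral_comp_smul_sub (fun w => ‖F w‖ₑ ^ 2) (by positivity), sq_eLpNorm_two, ← hpow,
      ENNReal.ofReal_mul (by positivity), ENNReal.ofReal_pow (by positivity), mul_assoc]
    congr 2
    rw [← ofReal_norm, Complex.norm_real, Real.norm_of_nonneg (by positivity)]
  refine ⟨shellSum φv L h, ?_, ?_⟩
  · have hM : eLpNorm χ 2 volume ^ 2 ≠ ⊤ :=
      ENNReal.pow_ne_top (hχc.memLp_of_hasCompactSupport hχs).eLpNorm_ne_top
    suffices H : wLp 2 ℓ (shellSum φv L h) ^ 2 < ⊤ by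
      by_contra h'
      simp [not_lt_top_iff.1 h'] at H
    rw [wLp, sq_eLpNorm_two]
    refine lt_of_le_of_lt (lintegral_mono fun v =>
      enorm_sq_jap_shellSum_le hdy hL hc₀ hh hℓ.le v) ?_
    rw [lintegral_tsum fun k => by
      refine AEMeasurable.const_mul ?_ _
      have : Continuous (h k) := by fun_prop
      exact (this.enorm.measurable.pow_const 2).aemeasurable]
    have hq : ∀ k, ∫⁻ v, ENNReal.ofReal (((4 * (2 : ℝ) ^ (L k : ℝ)) ^ ℓ / c₀) ^ 2) *
        ‖h k v‖ₑ ^ 2 = ENNReal.ofReal ((4 ^ ℓ / c₀) ^ 2) * eLpNorm χ 2 volume ^ 2 *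
          ENNReal.ofReal ((2 : ℝ) ^ (-2 * δ * a * N)) ^ (k + 1) := by
      intro k
      rw [lintegral_const_mul' _ _ ENNReal.ofReal_ne_top, hscale, ← mul_assoc,
        ← ENNReal.ofReal_mul (by positivity),
        mul_right_comm (ENNReal.ofReal ((4 ^ ℓ / c₀) ^ 2)),
        ← ENNReal.ofReal_pow (by positivity), ← ENNReal.ofReal_mul (by positivity)]
      congr 2
      rw [mul_rpow (by positivity) (by positivity), mul_div_right_comm, mul_pow, mul_assoc]
      congr 1
      rw [← rpow_mul zero_le_two, ← rpow_natCast, ← rpow_natCast, ← rpow_mul zero_le_two,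
        ← rpow_mul zero_le_two, ← rpow_add zero_lt_two]
      congr 1
      simp only [hJ]
      push_cast
      ring
    simp only [hq]
    rw [ENNReal.tsum_mul_left]
    refine ENNReal.mul_lt_top (ENNReal.mul_lt_top ENNReal.ofReal_lt_top hM.lt_top) ?_
    have hq1 : ENNReal.ofReal ((2 : ℝ) ^ (-2 * δ * a * N)) < 1 := by
      rw [ENNReal.ofReal_lt_one]
      refine rpow_lt_one_of_one_lt_of_neg one_lt_two ?_
      have : (0 : ℝ) < δ * a * N := by positivity
      linarith
    simp only [pow_succ]
    rw [ENNReal.tsum_mul_right, ENNReal.tsum_geometric]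
    refine ENNReal.mul_lt_top ?_ ENNReal.ofReal_lt_top
    rw [ENNReal.inv_lt_top]
    exact tsub_pos_of_lt hq1
  · set K : ℝ≥0∞ := eLpNorm (𝓕⁻ fun ξ => (φv ξ : ℂ) * 𝓕 χ ξ) 2 volume with hK
    have hterm : ∀ k, ENNReal.ofReal ((2 : ℝ) ^ (-2 * ℓ)) * K ^ 2 ≤
        ENNReal.ofReal ((2 : ℝ) ^ (2 * (ℓ + δ) * a * J k)) *
          eLpNorm (Fdy φv (J k) (Pdy φv (L k) (shellSum φv L h))) 2 volume ^ 2 := by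
      intro k
      have hF : Fdy φv (J k) (h k) = fun v => (((2 : ℝ) ^ e k : ℝ) : ℂ) *
          (𝓕⁻ fun ξ => (φv ξ : ℂ) * 𝓕 χ ξ)
            ((2 : ℝ) ^ (J k : ℝ) • (v - (2 : ℝ) ^ (L k : ℝ) • p)) := by
        funext v
        rw [← fourierInv_mul_fourier_comp_smul_sub (fun ξ => (φv ξ : ℂ)) χ (by positivity),
          ← rpow_neg zero_le_two]
        rfl
      have hE : eLpNorm (Fdy φv (J k) (h k)) 2 volume ^ 2 =
          ENNReal.ofReal ((2 : ℝ) ^ (-2 * ℓ * L k - 2 * δ * a * J k)) * K ^ 2 := by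
        rw [hF, sq_eLpNorm_two, hscale]
      rw [Pdy_shellSum hdy hL hh0, hE, ← mul_assoc,
        ← ENNReal.ofReal_mul (by positivity), ← rpow_add zero_lt_two]
      gcongr
      · exact one_le_two
      · have := mul_le_mul_of_nonneg_left (haL k).2 hℓ.le
        simp only [hJ]
        linarith
    refine top_unique ?_
    rw [← ENNReal.tsum_const_eq_top_of_ne_zero (α := ℕ)
      (c := ENNReal.ofReal ((2 : ℝ) ^ (-2 * ℓ)) * K ^ 2)
      (mul_ne_zero (by simp; positivity) (pow_ne_zero 2 hχK))]
    have hJi : Function.Injective J := fun k m hkm => by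
      have := Nat.eq_of_mul_eq_mul_left hN hkm
      omega
    refine le_trans (ENNReal.tsum_le_tsum fun k => ?_)
      (ENNReal.tsum_comp_le_tsum_of_injective hJi _)
    refine le_trans ?_ (ENNReal.le_tsum (L k))
    rw [if_pos ⟨Nat.mul_pos hN k.succ_pos, (haL k).1⟩]
    exact hterm k
end
end
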